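/- arXiv:2111.04030 — 2 statements merged into one kernel-verified Lean document; each statement's English description precedes it below -/
import Mathlib

section
/- There exists a sequence x ∈ {0,1}^∞ with finite-state dimension and finite-state strong dimension both equal to 1/2, such that for some integer k the Weyl averages (1/n) Σ_{j=0}^{n-1} e^{2πik·v(T^j x)} do not converge as n → ∞. -/
open MeasureTheory Filter Topology Real
open scoped ENNReal

noncomputable section

abbrev Cantor := ℕ → Bool

/-- `j`-fold left shift of a binary sequence. -/
def shiftk (x : Cantor) (j : ℕ) : Cantor := fun i => x (i + j)

/-- the left shift `T`. -/
def Tshift (x : Cantor) : Cantor := fun i => x (i + 1)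

/-- binary evaluation map `v`. -/
noncomputable def eval (x : Cantor) : ℝ := ∑' i : ℕ, if x i then ((2:ℝ) ^ (i + 1))⁻¹ else 0

noncomputable def negMulLog2 (p : ℝ) : ℝ := - p * Real.logb 2 p

/-- sliding count probability of a word `w` of length `l` in the prefix `x_0^{n-1}`. -/
noncomputable def slidingP (x : Cantor) (n l : ℕ) (w : Fin l → Bool) : ℝ :=
  (((Finset.range (n - l + 1)).filter (fun i => ∀ j : Fin l, x (i + (j : ℕ)) = w j)).card : ℝ)
    / ((n - l + 1 : ℕ) : ℝ)

/-- sliding block entropy `H_l(x_0^{n-1})`. -/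
noncomputable def slidingH (x : Cantor) (n l : ℕ) : ℝ :=
  (1 / (l : ℝ)) * ∑ w : Fin l → Bool, negMulLog2 (slidingP x n l w)

/-- disjoint block probability `P^d`. -/
noncomputable def disjP (x : Cantor) (n l : ℕ) (w : Fin l → Bool) : ℝ :=
  (((Finset.range (n / l)).filter (fun i => ∀ j : Fin l, x (l * i + (j : ℕ)) = w j)).card : ℝ)
    / ((n / l : ℕ) : ℝ)

/-- disjoint block entropy `H^d_l(x_0^{n-1})`. -/
noncomputable def disjH (x : Cantor) (n l : ℕ) : ℝ :=
  (1 / (l : ℝ)) * ∑ w : Fin l → Bool, negMulLog2 (disjP x n l w)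

/-- finite-state dimension via sliding block entropies. -/
noncomputable def dimFS (x : Cantor) : ℝ :=
  ⨅ l : ℕ, Filter.liminf (fun n => slidingH x n (l + 1)) Filter.atTop

/-- finite-state strong dimension. -/
noncomputable def DimFS (x : Cantor) : ℝ :=
  ⨅ l : ℕ, Filter.limsup (fun n => slidingH x n (l + 1)) Filter.atTop

/-- cylinder set. -/
def Cyl (l : ℕ) (w : Fin l → Bool) : Set Cantor := {y | ∀ j : Fin l, y (j : ℕ) = w j}

/-- empirical measures `ν_n = n⁻¹ ∑_{j<n} δ_{T^j x}` on Cantor space. -/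
noncomputable def empMeas (x : Cantor) (n : ℕ) : Measure Cantor :=
  (n : ℝ≥0∞)⁻¹ • ∑ j ∈ Finset.range n, Measure.dirac (shiftk x j)

/-- weak convergence of a sequence of measures. -/
def WeakConv {α : Type*} [TopologicalSpace α] [MeasurableSpace α]
    (ν : ℕ → Measure α) (μ : Measure α) : Prop :=
  ∀ f : BoundedContinuousFunction α ℂ,
    Tendsto (fun n => ∫ y, f y ∂(ν n)) atTop (nhds (∫ y, f y ∂μ))

/-- block entropy `H_n(μ)` of a measure on Cantor space. -/
noncomputable def measH (μ : Measure Cantor) (n : ℕ) : ℝ :=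
  ∑ w : Fin n → Bool, negMulLog2 ((μ (Cyl n w)).toReal)

/-- lower average entropy. -/
noncomputable def Hminus (μ : Measure Cantor) : ℝ :=
  Filter.liminf (fun n => measH μ n / n) Filter.atTop

/-- upper average entropy. -/
noncomputable def Hplus (μ : Measure Cantor) : ℝ :=
  Filter.limsup (fun n => measH μ n / n) Filter.atTop

/-- set of subsequence weak limits of the empirical measures of `x`. -/
def Wx (x : Cantor) : Set (Measure Cantor) :=
  {μ | IsProbabilityMeasure μ ∧
      ∃ φ : ℕ → ℕ, StrictMono φ ∧ (∀ m, 0 < φ m) ∧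
        WeakConv (fun m => empMeas x (φ m)) μ}

/-- normality of a binary sequence. -/
def IsNormal (x : Cantor) : Prop :=
  ∀ (l : ℕ) (w : Fin l → Bool),
    Tendsto (fun n => slidingP x n l w) atTop (nhds (((2:ℝ) ^ l)⁻¹))

/-- Weyl averages `(1/n) ∑_{j<n} e^{2πik v(T^j x)}`. -/
noncomputable def weylAvg (x : Cantor) (k : ℤ) (n : ℕ) : ℂ :=
  (n : ℂ)⁻¹ * ∑ j ∈ Finset.range n,
    Complex.exp (2 * (Real.pi : ℂ) * Complex.I * (k : ℂ) * ((eval (shiftk x j) : ℝ) : ℂ))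

/-- Weyl averages on the torus, `(1/n) ∑_{j<n} e^{2πik 2^j r}`. -/
noncomputable def weylAvgT (r : ℝ) (k : ℤ) (n : ℕ) : ℂ :=
  (n : ℂ)⁻¹ * ∑ j ∈ Finset.range n,
    Complex.exp (2 * (Real.pi : ℂ) * Complex.I * (k : ℂ) * (((2:ℝ) ^ j * r : ℝ) : ℂ))

/-- empirical measures `(1/n) ∑_{j<n} δ_{2^j r mod 1}` on the torus. -/
noncomputable def empMeasT (r : ℝ) (n : ℕ) : Measure UnitAddCircle :=
  (n : ℝ≥0∞)⁻¹ • ∑ j ∈ Finset.range n, Measure.dirac (((2:ℝ) ^ j * r : ℝ) : UnitAddCircle)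

/-- dyadic interval `[j/2^k, (j+1)/2^k)` on the torus. -/
def dyadicI (k j : ℕ) : Set UnitAddCircle :=
  (fun t : ℝ => (t : UnitAddCircle)) '' Set.Ico ((j : ℝ) / 2 ^ k) (((j : ℝ) + 1) / 2 ^ k)

/-- a real number is a dyadic rational. -/
def IsDyadic (t : ℝ) : Prop := ∃ (a : ℤ) (n : ℕ), t = (a : ℝ) / 2 ^ n

/-- value of a finite binary word. -/
noncomputable def val2 (l : ℕ) (w : Fin l → Bool) : ℝ :=
  ∑ j : Fin l, if w j then ((2:ℝ) ^ ((j : ℕ) + 1))⁻¹ else 0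

/-- dyadic interval `I_w` on the torus. -/
def IwT (l : ℕ) (w : Fin l → Bool) : Set UnitAddCircle :=
  (fun t : ℝ => (t : UnitAddCircle)) '' Set.Ico (val2 l w) (val2 l w + ((2:ℝ) ^ l)⁻¹)

/-- value of a finite base-`m` word. -/
noncomputable def valm (m n : ℕ) (w : Fin n → Fin m) : ℝ :=
  ∑ j : Fin n, ((w j : ℕ) : ℝ) / (m : ℝ) ^ ((j : ℕ) + 1)

/-- base-`m` interval `I^m_w` on the torus. -/
def ImT (m n : ℕ) (w : Fin n → Fin m) : Set UnitAddCircle :=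
  (fun t : ℝ => (t : UnitAddCircle)) '' Set.Ico (valm m n w) (valm m n w + ((m : ℝ) ^ n)⁻¹)

/-- base-`m` partition entropy `H^m_n(μ)` (natural logarithm). -/
noncomputable def measHT (μ : Measure UnitAddCircle) (m n : ℕ) : ℝ :=
  ∑ w : Fin n → Fin m, Real.negMulLog ((μ (ImT m n w)).toReal)

/-- lower Rényi dimension w.r.t. partition factor `m`. -/
noncomputable def renyiLower (μ : Measure UnitAddCircle) (m : ℕ) : ℝ :=
  Filter.liminf (fun n => measHT μ m n / (n * Real.log m)) Filter.atTop

/-- upper Rényi dimension w.r.t. partition factor `m`. -/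
noncomputable def renyiUpper (μ : Measure UnitAddCircle) (m : ℕ) : ℝ :=
  Filter.limsup (fun n => measHT μ m n / (n * Real.log m)) Filter.atTop

/-- number of occurrences of `u` at the first `n` positions of `a`. -/
def cnt (a : Cantor) (m : ℕ) (u : Fin m → Bool) (n : ℕ) : ℕ :=
  ((Finset.range n).filter (fun i => ∀ j : Fin m, a (i + (j : ℕ)) = u j)).card

/-- fair coin -/
def coin : Measure Bool := (2⁻¹ : ℝ≥0∞) • Measure.count

instance : IsProbabilityMeasure coin := ⟨by
  have h : Measure.count (Set.univ : Set Bool) = 2 := by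
    rw [Measure.count_apply_finite _ Set.finite_univ]
    simp
  rw [coin, Measure.smul_apply, h, smul_eq_mul]
  exact ENNReal.inv_mul_cancel (by norm_num) (by norm_num)⟩

lemma coin_singleton (b : Bool) : coin {b} = 2⁻¹ := by
  simp [coin]

/-- fair coin measure -/
def fairP : Measure Cantor := Measure.infinitePi (fun _ : ℕ => coin)

instance : IsProbabilityMeasure fairP := by unfold fairP; infer_instance

def blockAt (l i : ℕ) (a : Cantor) : Fin l → Bool := fun j => a (i + (j : ℕ))

lemma measurable_blockAt (l i : ℕ) : Measurable (blockAt l i) := by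
  unfold blockAt; fun_prop

lemma indep_coords : ProbabilityTheory.iIndepFun (fun (i : ℕ) (a : Cantor) => a i) fairP := 
  ProbabilityTheory.iIndepFun_infinitePi (P := fun _ : ℕ => coin) (X := fun _ b => b) (by fun_prop)

lemma map_blockAt (l i : ℕ) : fairP.map (blockAt l i) = Measure.infinitePi (fun _ : Fin l => coin) := by
  have h := indep_coords.precomp (g := fun j : Fin l => i + (j : ℕ)) 
    (by intro a b h; ext; simpa using h)
  have h2 := h.map_fun_eq_infinitePi_map (by fun_prop)
  have h3 : ∀ k, fairP.map (fun a : Cantor => a k) = coin := fun k =>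
    Measure.infinitePi_map_eval (fun _ : ℕ => coin) k
  simp only [h3] at h2
  exact h2

lemma indep_blockAt (l i i' : ℕ) (h : i + l ≤ i' ∨ i' + l ≤ i) :
    ProbabilityTheory.IndepFun (blockAt l i) (blockAt l i') fairP := by
  have key := indep_coords.indepFun_finset (Finset.Ico i (i + l)) (Finset.Ico i' (i' + l))
    (by
      rw [Finset.disjoint_left]
      intro a h1 h2
      simp only [Finset.mem_Ico] at h1 h2
      omega) (by fun_prop)
  have h1 : Measurable (fun (f : Finset.Ico i (i + l) → Bool) (j : Fin l) =>
      f ⟨i + j, by simp⟩) := by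
    rw [measurable_pi_iff]; intro j; exact measurable_pi_apply _
  have h2 : Measurable (fun (f : Finset.Ico i' (i' + l) → Bool) (j : Fin l) =>
      f ⟨i' + j, by simp⟩) := by
    rw [measurable_pi_iff]; intro j; exact measurable_pi_apply _
  exact key.comp h1 h2

def indW (l : ℕ) (w : Fin l → Bool) (v : Fin l → Bool) : ℝ := Set.indicator {w} 1 v

lemma measurable_indW (l : ℕ) (w : Fin l → Bool) : Measurable (indW l w) :=
  measurable_of_countable _

lemma slln_block (l r : ℕ) (hl : 0 < l) (w : Fin l → Bool) : ∀ᵐ a ∂fairP,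
    Tendsto (fun n : ℕ => (∑ k ∈ Finset.range n, indW l w (blockAt l (r + l * k) a)) / (n : ℝ))
      atTop (𝓝 ((2 : ℝ) ^ l)⁻¹) := by
  have h := ProbabilityTheory.strong_law_ae_real (μ := fairP)
    (fun k a => indW l w (blockAt l (r + l * k) a)) ?_ ?_ ?_
  · have h2 : ∫ a, indW l w (blockAt l (r + l * 0) a) ∂fairP = ((2 : ℝ) ^ l)⁻¹ := by
      rw [← integral_map (φ := blockAt l (r + l * 0)) (f := indW l w)
        (measurable_blockAt _ _).aemeasurable
        (measurable_indW l w).aestronglyMeasurable, map_blockAt]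
      unfold indW
      rw [integral_indicator_one (measurableSet_singleton w), measureReal_def,
        Measure.infinitePi_singleton]
      simp [coin_singleton]
    rw [h2] at h
    exact h
  · refine Integrable.of_bound (C := 1) ((measurable_indW l w).comp (measurable_blockAt _ _)).aestronglyMeasurable ?_
    refine ae_of_all _ fun a => ?_
    unfold indW Set.indicator
    split_ifs <;> simp
  · intro k k' hk
    refine (indep_blockAt l (r + l * k) (r + l * k') ?_).comp (measurable_indW l w) (measurable_indW l w)
    rcases lt_or_gt_of_ne hk with h | h
    · left; nlinarith
    · right; nlinarith
  · intro k
    have : ProbabilityTheory.IdentDistrib (blockAt l (r + l * k)) (blockAt l (r + l * 0)) fairP fairP :=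
      ⟨(measurable_blockAt _ _).aemeasurable, (measurable_blockAt _ _).aemeasurable, by
        rw [map_blockAt, map_blockAt]⟩
    exact this.comp (measurable_indW l w)

lemma cnt_eq_sum (a : Cantor) (l : ℕ) (w : Fin l → Bool) (n : ℕ) :
    (cnt a l w n : ℝ) = ∑ i ∈ Finset.range n, indW l w (blockAt l i a) := by
  unfold cnt indW blockAt Set.indicator
  rw [Finset.card_filter]
  push_cast
  refine Finset.sum_congr rfl fun i _ => ?_
  simp [funext_iff]

lemma cnt_mono (a : Cantor) (l : ℕ) (w : Fin l → Bool) {n m : ℕ} (h : n ≤ m) :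
    cnt a l w n ≤ cnt a l w m := by
  unfold cnt
  exact Finset.card_le_card (Finset.filter_subset_filter _ (Finset.range_mono h))

lemma sum_residue (f : ℕ → ℝ) (l q : ℕ) :
    ∑ i ∈ Finset.range (l * q), f i = ∑ r ∈ Finset.range l, ∑ k ∈ Finset.range q, f (r + l * k) := by
  rw [Finset.sum_comm]
  induction q with
  | zero => simp
  | succ q ih =>
    rw [Nat.mul_succ, Finset.sum_range_add, ih, Finset.sum_range_succ]
    congr 1
    refine Finset.sum_congr rfl fun r _ => ?_
    rw [add_comm]

lemma tendsto_cnt_of_blocks (a : Cantor) (l : ℕ) (hl : 0 < l) (w : Fin l → Bool)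
    (h : ∀ r, Tendsto (fun n : ℕ => (∑ k ∈ Finset.range n, indW l w (blockAt l (r + l * k) a)) / (n : ℝ))
      atTop (𝓝 ((2 : ℝ) ^ l)⁻¹)) :
    Tendsto (fun n : ℕ => (cnt a l w n : ℝ) / n) atTop (𝓝 ((2 : ℝ) ^ l)⁻¹) := by
  have hl' : (0 : ℝ) < l := by exact_mod_cast hl
  have h1 : Tendsto (fun q : ℕ => (cnt a l w (l * q) : ℝ) / q) atTop (𝓝 (l * ((2 : ℝ) ^ l)⁻¹)) := by
    have := tendsto_finsetSum (Finset.range l) (fun r _ => h r)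
    simp only [Finset.sum_const, Finset.card_range, nsmul_eq_mul] at this
    refine this.congr fun q => ?_
    rw [cnt_eq_sum, sum_residue, Finset.sum_div]
  have hdiv : Tendsto (fun n : ℕ => n / l) atTop atTop := Nat.tendsto_div_const_atTop hl.ne'
  have hq : Tendsto (fun n : ℕ => ((n / l : ℕ) : ℝ) / n) atTop (𝓝 ((l : ℝ)⁻¹)) := by
    have := (tendsto_nat_floor_mul_div_atTop (R := ℝ) (a := (l : ℝ)⁻¹) (by positivity)).comp
      (tendsto_natCast_atTop_atTop (R := ℝ))
    refine this.congr fun n => ?_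
    simp only [Function.comp]
    congr 2
    rw [← Nat.floor_div_eq_div (K := ℝ), div_eq_inv_mul]
  have hlow : Tendsto (fun n : ℕ => (cnt a l w (l * (n / l)) : ℝ) / (n / l : ℕ) * (((n / l : ℕ) : ℝ) / n))
      atTop (𝓝 ((2 : ℝ) ^ l)⁻¹) := by
    have := (h1.comp hdiv).mul hq
    rw [mul_right_comm, mul_inv_cancel₀ hl'.ne', one_mul] at this
    exact this
  have hhi : Tendsto (fun n : ℕ => (cnt a l w (l * (n / l + 1)) : ℝ) / (n / l + 1 : ℕ) *
      (((n / l : ℕ) : ℝ) / n + 1 / n))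
      atTop (𝓝 ((2 : ℝ) ^ l)⁻¹) := by
    have := (h1.comp ((tendsto_add_atTop_nat 1).comp hdiv)).mul (hq.add (tendsto_one_div_atTop_nhds_zero_nat (𝕜 := ℝ)))
    rw [add_zero, mul_right_comm, mul_inv_cancel₀ hl'.ne', one_mul] at this
    exact this
  refine tendsto_of_tendsto_of_tendsto_of_le_of_le' hlow hhi ?_ ?_
  · filter_upwards [eventually_ge_atTop l] with n hn
    have hp : 0 < n / l := Nat.div_pos hn hl
    have hp' : (0 : ℝ) < (n / l : ℕ) := by exact_mod_cast hp
    rw [div_mul_div_cancel₀ hp'.ne']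
    gcongr
    exact cnt_mono _ _ _ (Nat.mul_div_le n l)
  · filter_upwards [eventually_ge_atTop l] with n hn
    have hp' : (0 : ℝ) < (n / l + 1 : ℕ) := by positivity
    rw [← add_div]
    have : ((n / l : ℕ) : ℝ) + 1 = (n / l + 1 : ℕ) := by push_cast; ring
    rw [this, div_mul_div_cancel₀ hp'.ne']
    gcongr
    exact cnt_mono _ _ _ (Nat.lt_mul_div_succ n hl).le

lemma exists_normal : ∃ a : Cantor, ∀ (l : ℕ) (w : Fin l → Bool),
    Tendsto (fun n : ℕ => (cnt a l w n : ℝ) / n) atTop (𝓝 ((2 : ℝ) ^ l)⁻¹) := by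
  have h : ∀ᵐ a ∂fairP, ∀ l : ℕ, 0 < l → ∀ w : Fin l → Bool, ∀ r : ℕ,
      Tendsto (fun n : ℕ => (∑ k ∈ Finset.range n, indW l w (blockAt l (r + l * k) a)) / (n : ℝ))
      atTop (𝓝 ((2 : ℝ) ^ l)⁻¹) := by
    rw [ae_all_iff]; intro l
    by_cases hl : 0 < l
    · simp only [hl, true_imp_iff]
      rw [ae_all_iff]; intro w
      rw [ae_all_iff]; intro r
      exact slln_block l r hl w
    · simp [hl]
  obtain ⟨a, ha⟩ := h.exists
  refine ⟨a, fun l w => ?_⟩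
  rcases Nat.eq_zero_or_pos l with rfl | hl
  · have : (fun n : ℕ => (cnt a 0 w n : ℝ) / n) =ᶠ[atTop] fun _ => ((2 : ℝ) ^ 0)⁻¹ := by
      filter_upwards [eventually_gt_atTop 0] with n hn
      have : (n : ℝ) ≠ 0 := by positivity
      simp [cnt, this]
    exact tendsto_const_nhds.congr' this.symm
  · exact tendsto_cnt_of_blocks a l hl w (ha l hl w)

/-- filler bits, constant on dyadic ranges. -/
def bet (i : ℕ) : Bool := decide (Nat.log 2 i % 2 = 1)

/-- alternate the bits of `a` with filler bits. -/
def mix (a : Cantor) : Cantor := fun n => if n % 2 = 0 then a (n / 2) else bet (n / 2 + 1)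

lemma mix_even (a : Cantor) (i : ℕ) : mix a (2 * i) = a i := by
  simp [mix]

lemma mix_odd (a : Cantor) (i : ℕ) : mix a (2 * i + 1) = bet (i + 1) := by
  have h1 : (2 * i + 1) % 2 = 1 := by omega
  have h2 : (2 * i + 1) / 2 = i := by omega
  simp [mix, h1, h2]

/-- frequencies -/
def frq {ι : Type} [DecidableEq ι] (y : ℕ → ι) (E : ℕ) (w : ι) : ℝ :=
  (∑ i ∈ Finset.range E, if y i = w then (1 : ℝ) else 0) / E

lemma frq_nonneg {ι : Type} [DecidableEq ι] (y : ℕ → ι) (E : ℕ) (w : ι) : 0 ≤ frq y E w := by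
  unfold frq
  refine div_nonneg (Finset.sum_nonneg fun i _ => ?_) (by positivity)
  split_ifs <;> simp

lemma frq_sum {ι : Type} [Fintype ι] [DecidableEq ι] (y : ℕ → ι) (E : ℕ) (hE : 0 < E) :
    ∑ w, frq y E w = 1 := by
  unfold frq
  rw [← Finset.sum_div, Finset.sum_comm]
  have : (E : ℝ) ≠ 0 := by positivity
  simp [this]

lemma slidingP_eq (x : Cantor) (n l : ℕ) (w : Fin l → Bool) :
    slidingP x n l w = frq (fun i => blockAt l i x) (n - l + 1) w := by
  unfold slidingP frq blockAt
  rw [Finset.card_filter]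
  push_cast
  congr 1
  refine Finset.sum_congr rfl fun i _ => ?_
  simp [funext_iff]

lemma sum_even_odd (f : ℕ → ℝ) (N : ℕ) : ∑ p ∈ Finset.range N, f p =
    ∑ i ∈ Finset.range ((N + 1) / 2), f (2 * i) + ∑ i ∈ Finset.range (N / 2), f (2 * i + 1) := by
  induction N with
  | zero => simp
  | succ N ih =>
    rw [Finset.sum_range_succ, ih]
    rcases Nat.even_or_odd' N with ⟨k, rfl | rfl⟩
    · have h1 : (2 * k + 1) / 2 = k := by omega
      have h2 : (2 * k + 1 + 1) / 2 = k + 1 := by omega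
      have h3 : 2 * k / 2 = k := by omega
      rw [h1, h2, h3, Finset.sum_range_succ]; ring
    · have h1 : (2 * k + 1) / 2 = k := by omega
      have h2 : (2 * k + 1 + 1) / 2 = k + 1 := by omega
      have h3 : (2 * k + 1 + 1 + 1) / 2 = k + 1 := by omega
      rw [h1, h2, h3, Finset.sum_range_succ (fun i => f (2 * i + 1)) k]; ring

lemma negMulLog2_eq (p : ℝ) : negMulLog2 p = Real.negMulLog p / Real.log 2 := by
  unfold negMulLog2 Real.negMulLog Real.logb; ring

lemma negMulLog2_concave (x y θ : ℝ) (hx : 0 ≤ x) (hy : 0 ≤ y) (h0 : 0 ≤ θ) (h1 : θ ≤ 1) :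
    θ * negMulLog2 x + (1 - θ) * negMulLog2 y ≤ negMulLog2 (θ * x + (1 - θ) * y) := by
  have := Real.concaveOn_negMulLog.2 (x := x) hx (y := y) hy h0 (sub_nonneg.2 h1) (by ring)
  simp only [smul_eq_mul] at this
  simp only [negMulLog2_eq]
  rw [← mul_div_assoc, ← mul_div_assoc, ← add_div]
  gcongr

lemma negMulLog2_lower (q A : ℝ) (hq : 0 ≤ q) (h : q ≤ (2 : ℝ) ^ (-A)) :
    A * q ≤ negMulLog2 q := by
  rcases hq.eq_or_lt with rfl | hq
  · simp [negMulLog2]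
  · unfold negMulLog2
    have : Real.logb 2 q ≤ -A := by
      rw [Real.logb_le_iff_le_rpow (by norm_num) hq]; exact h
    nlinarith

lemma ent_lower {ι : Type} [Fintype ι] (p q r : ι → ℝ) (θ A B : ℝ)
    (h0 : 0 ≤ θ) (h1 : θ ≤ 1) (hp : ∀ w, p w = θ * q w + (1 - θ) * r w)
    (hq : ∀ w, 0 ≤ q w) (hr : ∀ w, 0 ≤ r w) (hqs : ∑ w, q w = 1) (hrs : ∑ w, r w = 1)
    (hqA : ∀ w, q w ≤ (2 : ℝ) ^ (-A)) (hrB : ∀ w, r w ≤ (2 : ℝ) ^ (-B)) :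
    θ * A + (1 - θ) * B ≤ ∑ w, negMulLog2 (p w) := by
  have e : θ * A + (1 - θ) * B = ∑ w, (θ * (A * q w) + (1 - θ) * (B * r w)) := by
    rw [Finset.sum_add_distrib, ← Finset.mul_sum, ← Finset.mul_sum, ← Finset.mul_sum,
      ← Finset.mul_sum, hqs, hrs]; ring
  rw [e]
  refine Finset.sum_le_sum fun w _ => ?_
  rw [hp]
  refine le_trans ?_ (negMulLog2_concave _ _ _ (hq w) (hr w) h0 h1)
  have a1 := negMulLog2_lower _ _ (hq w) (hqA w)
  have a2 := negMulLog2_lower _ _ (hr w) (hrB w)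
  have : 0 ≤ 1 - θ := sub_nonneg.2 h1
  gcongr

lemma ent_upper {ι : Type} [Fintype ι] [DecidableEq ι] (p : ι → ℝ) (S : Finset ι)
    (hp : ∀ w, 0 ≤ p w) (hs : ∑ w, p w = 1) (hS : ∀ w, w ∉ S → p w = 0) :
    ∑ w, negMulLog2 (p w) ≤ Real.logb 2 S.card := by
  have hs' : ∑ w ∈ S, p w = 1 := by
    rw [← hs]; exact Finset.sum_subset (Finset.subset_univ _) fun w _ h => hS w h
  have hne : S.Nonempty := by
    by_contra h
    rw [Finset.not_nonempty_iff_eq_empty] at h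
    simp [h] at hs'
  have hc : (0 : ℝ) < S.card := by exact_mod_cast hne.card_pos
  have e : ∑ w, negMulLog2 (p w) = ∑ w ∈ S, negMulLog2 (p w) := by
    symm
    exact Finset.sum_subset (Finset.subset_univ _) fun w _ h => by simp [hS w h, negMulLog2]
  rw [e]
  simp only [negMulLog2_eq, Real.logb]
  rw [← Finset.sum_div]
  have hl2 : 0 < Real.log 2 := Real.log_pos (by norm_num)
  gcongr
  have key : ∀ w ∈ S, Real.negMulLog (p w) ≤ p w * Real.log S.card + (1 / S.card - p w) := by
    intro w _
    rcases (hp w).eq_or_lt with h | h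
    · rw [← h]; simp
    · have h3 := Real.log_le_sub_one_of_pos (x := 1 / (p w * S.card)) (by positivity)
      rw [one_div, Real.log_inv, Real.log_mul h.ne' hc.ne'] at h3
      have h4 := mul_le_mul_of_nonneg_left h3 h.le
      have h5 : p w * ((p w * S.card)⁻¹ - 1) = 1 / S.card - p w := by field_simp
      unfold Real.negMulLog
      nlinarith
  refine (Finset.sum_le_sum key).trans ?_
  rw [Finset.sum_add_distrib, Finset.sum_sub_distrib, ← Finset.sum_mul, hs']
  have : (S.card : ℝ) ≠ 0 := hc.ne'
  simp [this]

lemma frq_even_le (a : Cantor) (l E : ℕ) (w : Fin l → Bool) :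
    frq (fun i => blockAt l (2 * i) (mix a)) E w ≤
      (cnt a ((l + 1) / 2) (fun j => w ⟨2 * j, by omega⟩) E : ℝ) / E := by
  rw [cnt_eq_sum]
  unfold frq
  gcongr with i _
  unfold indW Set.indicator
  by_cases h : blockAt l (2 * i) (mix a) = w
  · rw [if_pos h, if_pos]
    · rfl
    · simp only [Set.mem_singleton_iff]
      funext j
      rw [← h]
      simp only [blockAt]
      rw [← mul_add, mix_even]
  · rw [if_neg h]
    split_ifs <;> simp

lemma frq_odd_le (a : Cantor) (l E : ℕ) (w : Fin l → Bool) :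
    frq (fun i => blockAt l (2 * i + 1) (mix a)) E w ≤
      (cnt a (l / 2) (fun j => w ⟨2 * j + 1, by omega⟩) (E + 1) : ℝ) / E := by
  rw [cnt_eq_sum, Finset.sum_range_succ']
  unfold frq
  gcongr
  refine le_add_of_le_of_nonneg ?_ ?_
  · refine Finset.sum_le_sum fun i _ => ?_
    unfold indW Set.indicator
    by_cases h : blockAt l (2 * i + 1) (mix a) = w
    · rw [if_pos h, if_pos]
      · rfl
      · simp only [Set.mem_singleton_iff]
        funext j
        rw [← h]
        simp only [blockAt]
        rw [show 2 * i + 1 + (2 * (j : ℕ) + 1) = 2 * (i + 1 + j) by ring, mix_even]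
    · rw [if_neg h]
      split_ifs <;> simp
  · unfold indW Set.indicator
    split_ifs <;> simp

def NormalSeq (a : Cantor) : Prop := ∀ (l : ℕ) (w : Fin l → Bool),
    Tendsto (fun n : ℕ => (cnt a l w n : ℝ) / n) atTop (𝓝 ((2 : ℝ) ^ l)⁻¹)

lemma rpow_gap (m : ℕ) (ε : ℝ) (hε : 0 < ε) : ((2 : ℝ) ^ m)⁻¹ < (2 : ℝ) ^ (-((m : ℝ) - ε)) := by
  rw [← Real.rpow_natCast, ← Real.rpow_neg (by norm_num)]
  exact Real.rpow_lt_rpow_of_exponent_lt (by norm_num) (by linarith)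

lemma slidingH_lower (a : Cantor) (ha : NormalSeq a) (l : ℕ) (hl : 0 < l) (ε : ℝ) (hε : 0 < ε) :
    ∀ᶠ n in atTop, 1 / 2 - ε ≤ slidingH (mix a) n l := by
  have hN : Tendsto (fun n : ℕ => n - l + 1) atTop atTop :=
    (tendsto_add_atTop_nat 1).comp (tendsto_sub_atTop_nat l)
  have hO : Tendsto (fun n : ℕ => (n - l + 1) / 2) atTop atTop :=
    (Nat.tendsto_div_const_atTop (by norm_num)).comp hN
  have hE : Tendsto (fun n : ℕ => (n - l + 1 + 1) / 2) atTop atTop :=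
    (Nat.tendsto_div_const_atTop (by norm_num)).comp ((tendsto_add_atTop_nat 1).comp hN)
  have he : ∀ᶠ E : ℕ in atTop, ∀ u : Fin ((l + 1) / 2) → Bool,
      (cnt a ((l + 1) / 2) u E : ℝ) / E ≤ (2 : ℝ) ^ (-((((l + 1) / 2 : ℕ) : ℝ) - ε)) := by
    rw [eventually_all]
    intro u
    exact (ha _ u).eventually_le_const (rpow_gap _ ε hε)
  have ho : ∀ᶠ E : ℕ in atTop, ∀ u : Fin (l / 2) → Bool,
      (cnt a (l / 2) u (E + 1) : ℝ) / E ≤ (2 : ℝ) ^ (-(((l / 2 : ℕ) : ℝ) - ε)) := by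
    rw [eventually_all]
    intro u
    have h1 := (ha _ u).comp (tendsto_add_atTop_nat 1)
    have h2 : Tendsto (fun E : ℕ => 1 + 1 / (E : ℝ)) atTop (𝓝 1) := by
      simpa using (tendsto_one_div_atTop_nhds_zero_nat (𝕜 := ℝ)).const_add 1
    have h3 := h1.mul h2
    rw [mul_one] at h3
    filter_upwards [h3.eventually_le_const (rpow_gap _ ε hε), eventually_gt_atTop 0] with E h4 h5
    refine le_trans (le_of_eq ?_) h4
    have : (E : ℝ) ≠ 0 := by positivity
    have : (E : ℝ) + 1 ≠ 0 := by positivity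
    simp only [Function.comp]
    push_cast
    field_simp
  filter_upwards [hE.eventually he, hO.eventually ho, hO.eventually (eventually_gt_atTop 0)]
    with n h1 h2 h3
  set N := n - l + 1 with hNdef
  have hNpos : (0 : ℝ) < N := by rw [hNdef]; positivity
  have hO0 : (0 : ℝ) < (N / 2 : ℕ) := by exact_mod_cast h3
  have hE0' : 0 < (N + 1) / 2 := by omega
  have hE0 : (0 : ℝ) < ((N + 1) / 2 : ℕ) := by exact_mod_cast hE0'
  have hsum : (((N + 1) / 2 : ℕ) : ℝ) + (N / 2 : ℕ) = N := by
    have : (N + 1) / 2 + N / 2 = N := by omega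
    exact_mod_cast this
  have hge : ((N / 2 : ℕ) : ℝ) ≤ ((N + 1) / 2 : ℕ) := by
    have : N / 2 ≤ (N + 1) / 2 := by omega
    exact_mod_cast this
  set θ : ℝ := (((N + 1) / 2 : ℕ) : ℝ) / N with hθ
  have hθ1 : 1 - θ = ((N / 2 : ℕ) : ℝ) / N := by
    rw [hθ]; field_simp; linarith
  have key := ent_lower (fun w => slidingP (mix a) n l w)
    (fun w => frq (fun i => blockAt l (2 * i) (mix a)) ((N + 1) / 2) w)
    (fun w => frq (fun i => blockAt l (2 * i + 1) (mix a)) (N / 2) w)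
    θ ((((l + 1) / 2 : ℕ) : ℝ) - ε) (((l / 2 : ℕ) : ℝ) - ε) (by positivity)
    (by
      have : 0 ≤ 1 - θ := by rw [hθ1]; positivity
      linarith)
    (by
      intro w
      rw [slidingP_eq, ← hNdef, hθ1]
      unfold frq
      rw [sum_even_odd, hθ]
      field_simp)
    (fun w => frq_nonneg _ _ _) (fun w => frq_nonneg _ _ _)
    (frq_sum _ _ hE0') (frq_sum _ _ h3)
    (fun w => (frq_even_le a l _ w).trans (h1 _))
    (fun w => (frq_odd_le a l _ w).trans (h2 _))
  have hθ2 : 1 / 2 ≤ θ := by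
    rw [hθ, div_le_div_iff₀ (by norm_num) hNpos]; linarith
  have hlsum : (((l + 1) / 2 : ℕ) : ℝ) + (l / 2 : ℕ) = l := by
    have : (l + 1) / 2 + l / 2 = l := by omega
    exact_mod_cast this
  have hlge : ((l / 2 : ℕ) : ℝ) ≤ ((l + 1) / 2 : ℕ) := by
    have : l / 2 ≤ (l + 1) / 2 := by omega
    exact_mod_cast this
  have hl1 : (1 : ℝ) ≤ l := by exact_mod_cast hl
  unfold slidingH
  have h6 : (l : ℝ) / 2 - ε ≤ ∑ w, negMulLog2 (slidingP (mix a) n l w) := by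
    refine le_trans ?_ key
    nlinarith
  rw [one_div_mul_eq_div, le_div_iff₀ (by linarith)]
  refine le_trans ?_ h6
  nlinarith

/-- all words occurring in the filler sequence -/
def fillC (m : ℕ) : Finset (Fin m → Bool) :=
  (Finset.range m).image (fun s (j : Fin m) => bet (s + j)) ∪
  ((Finset.univ : Finset Bool) ×ˢ Finset.range (m + 1)).image
    (fun bt (j : Fin m) => if (j : ℕ) < bt.2 then bt.1 else !bt.1)

lemma fillC_card (m : ℕ) : (fillC m).card ≤ 3 * m + 2 := by
  unfold fillC
  refine (Finset.card_union_le _ _).trans ?_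
  have h1 := Finset.card_image_le (s := Finset.range m) (f := fun s (j : Fin m) => bet (s + j))
  have h2 := Finset.card_image_le (s := (Finset.univ : Finset Bool) ×ˢ Finset.range (m + 1))
    (f := fun bt (j : Fin m) => if (j : ℕ) < bt.2 then bt.1 else !bt.1)
  simp only [Finset.card_product, Finset.card_range, Finset.card_univ, Fintype.card_bool] at h1 h2
  omega

lemma mem_fillC (m s : ℕ) (hs : 0 < s) : (fun j : Fin m => bet (s + j)) ∈ fillC m := by
  unfold fillC
  rw [Finset.mem_union]
  by_cases h : s < m
  · left
    exact Finset.mem_image.2 ⟨s, Finset.mem_range.2 h, rfl⟩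
  · right
    push Not at h
    have k1 : 2 ^ Nat.log 2 s ≤ s := Nat.pow_log_le_self 2 hs.ne'
    have k2 : s < 2 ^ (Nat.log 2 s + 1) := Nat.lt_pow_succ_log_self (by norm_num) s
    refine Finset.mem_image.2 ⟨(bet s, min m (2 ^ (Nat.log 2 s + 1) - s)), ?_, ?_⟩
    · simp only [Finset.mem_product, Finset.mem_univ, Finset.mem_range, true_and]
      omega
    · funext j
      have hj := j.2
      dsimp only
      split_ifs with hlt
      · have : Nat.log 2 (s + j) = Nat.log 2 s := by
          rw [Nat.log_eq_iff (Or.inr ⟨by norm_num, by omega⟩)]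
          omega
        simp [bet, this]
      · have : Nat.log 2 (s + j) = Nat.log 2 s + 1 := by
          rw [Nat.log_eq_iff (Or.inr ⟨by norm_num, by omega⟩)]
          have : 2 ^ (Nat.log 2 s + 1 + 1) = 2 * 2 ^ (Nat.log 2 s + 1) := by ring
          omega
        simp only [bet, this]
        rcases Nat.mod_two_eq_zero_or_one (Nat.log 2 s) with h0 | h0
        · have : (Nat.log 2 s + 1) % 2 = 1 := by omega
          simp [h0, this]
        · have : (Nat.log 2 s + 1) % 2 = 0 := by omega
          simp [h0, this]

def suppS (l : ℕ) : Finset (Fin l → Bool) :=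
  ((Finset.univ : Finset Bool) ×ˢ ((Finset.univ : Finset (Fin ((l + 1) / 2) → Bool)) ×ˢ
    fillC ((l + 1) / 2))).image
    (fun z (j : Fin l) => if decide ((j : ℕ) % 2 = 0) = z.1 then z.2.1 ⟨j / 2, by omega⟩
      else z.2.2 ⟨j / 2, by omega⟩)

lemma suppS_card (l : ℕ) : (suppS l).card ≤ 2 * (2 ^ ((l + 1) / 2) * (3 * ((l + 1) / 2) + 2)) := by
  unfold suppS
  refine Finset.card_image_le.trans ?_
  simp only [Finset.card_product, Finset.card_univ, Fintype.card_bool, Fintype.card_fun,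
    Fintype.card_fin]
  gcongr
  exact fillC_card _

lemma mem_suppS (a : Cantor) (l p : ℕ) : blockAt l p (mix a) ∈ suppS l := by
  unfold suppS
  rw [Finset.mem_image]
  rcases Nat.even_or_odd' p with ⟨i, rfl | rfl⟩
  · refine ⟨(true, (fun j => a (i + j)), (fun j => bet (i + 1 + j))), ?_, ?_⟩
    · simp only [Finset.mem_product, Finset.mem_univ, true_and]
      exact mem_fillC _ _ (by omega)
    · funext j
      simp only [decide_eq_true_eq, blockAt]
      split_ifs with h
      · rw [show 2 * i + (j : ℕ) = 2 * (i + j / 2) by omega, mix_even]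
      · rw [show 2 * i + (j : ℕ) = 2 * (i + j / 2) + 1 by omega, mix_odd]
        congr 1; ring
  · refine ⟨(false, (fun j => a (i + 1 + j)), (fun j => bet (i + 1 + j))), ?_, ?_⟩
    · simp only [Finset.mem_product, Finset.mem_univ, true_and]
      exact mem_fillC _ _ (by omega)
    · funext j
      simp only [decide_eq_false_iff_not, blockAt]
      split_ifs with h
      · rw [show 2 * i + 1 + (j : ℕ) = 2 * (i + j / 2) + 1 by omega, mix_odd]
        congr 1; ring
      · rw [show 2 * i + 1 + (j : ℕ) = 2 * (i + 1 + j / 2) by omega, mix_even]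

lemma slidingH_upper (a : Cantor) (l n : ℕ) :
    slidingH (mix a) n l ≤ (1 / (l : ℝ)) *
      Real.logb 2 (2 * (2 ^ ((l + 1) / 2) * (3 * ((l + 1) / 2 : ℕ) + 2))) := by
  unfold slidingH
  gcongr
  have hpos : 0 < n - l + 1 := by omega
  refine (ent_upper (fun w => slidingP (mix a) n l w) (suppS l) ?_ ?_ ?_).trans ?_
  · intro w; rw [slidingP_eq]; exact frq_nonneg _ _ _
  · simp only [slidingP_eq]; exact frq_sum _ _ hpos
  · intro w hw
    rw [slidingP_eq]
    unfold frq
    rw [Finset.sum_eq_zero, zero_div]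
    intro i _
    rw [if_neg]
    rintro rfl
    exact hw (mem_suppS a l i)
  · have h1 : 0 < (suppS l).card := Finset.card_pos.2 ⟨_, mem_suppS (fun _ => true) l 0⟩
    refine Real.logb_le_logb_of_le (by norm_num) (by exact_mod_cast h1) ?_
    exact_mod_cast suppS_card l

lemma upper_bound_pow (a : Cantor) (s n : ℕ) :
    slidingH (mix a) n (2 ^ (s + 1)) ≤ 1 / 2 + ((s : ℝ) + 4) * (1 / 2) ^ (s + 1) := by
  refine (slidingH_upper a _ n).trans ?_
  have h : (2 ^ (s + 1) + 1) / 2 = 2 ^ s := by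
    rw [pow_succ]; omega
  rw [h]
  have h2 : Real.logb 2 (2 * (2 ^ (2 ^ s) * (3 * ((2 ^ s : ℕ) : ℝ) + 2))) ≤ (2 : ℝ) ^ s + s + 4 := by
    rw [Real.logb_le_iff_le_rpow (by norm_num) (by positivity)]
    have e : (2 : ℝ) ^ ((2 : ℝ) ^ s + s + 4) = 2 ^ (2 ^ s) * 2 ^ s * 16 := by
      have : ((2 : ℝ) ^ s + s + 4) = ((2 ^ s + s + 4 : ℕ) : ℝ) := by push_cast; ring
      rw [this, Real.rpow_natCast, pow_add, pow_add]; norm_num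
    rw [e]
    have hs : (1 : ℝ) ≤ 2 ^ s := one_le_pow₀ (by norm_num)
    have hb : (0 : ℝ) < 2 ^ (2 ^ s) := by positivity
    push_cast
    have : 2 * (3 * (2 : ℝ) ^ s + 2) ≤ 2 ^ s * 16 := by linarith
    nlinarith
  calc _ ≤ 1 / ((2 ^ (s + 1) : ℕ) : ℝ) * ((2 : ℝ) ^ s + s + 4) := by gcongr
    _ = _ := by
      push_cast
      rw [one_div_pow, pow_succ]
      field_simp
      ring

lemma tail_tendsto : Tendsto (fun s : ℕ => ((s : ℝ) + 4) * (1 / 2) ^ (s + 1)) atTop (𝓝 0) := by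
  have h1 := tendsto_pow_const_mul_const_pow_of_abs_lt_one 1 (r := (1 / 2 : ℝ)) (by norm_num [abs_lt])
  have h2 := tendsto_pow_const_mul_const_pow_of_abs_lt_one 0 (r := (1 / 2 : ℝ)) (by norm_num [abs_lt])
  have h3 := (h1.add (h2.const_mul 4)).mul_const (1 / 2)
  simp only [mul_zero, add_zero, zero_mul] at h3
  refine h3.congr fun s => ?_
  simp only [pow_one, pow_zero]
  ring

lemma dims (a : Cantor) (ha : NormalSeq a) : dimFS (mix a) = 1 / 2 ∧ DimFS (mix a) = 1 / 2 := by
  have hbdA : ∀ l : ℕ, IsBoundedUnder (· ≤ ·) atTop (fun n => slidingH (mix a) n (l + 1)) := fun l =>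
    ⟨_, eventually_map.2 (Eventually.of_forall fun n => slidingH_upper a (l + 1) n)⟩
  have hbdB : ∀ l : ℕ, IsBoundedUnder (· ≥ ·) atTop (fun n => slidingH (mix a) n (l + 1)) := fun l =>
    ⟨_, eventually_map.2 (slidingH_lower a ha (l + 1) (by omega) 1 one_pos)⟩
  have hlow : ∀ l : ℕ, 1 / 2 ≤ liminf (fun n => slidingH (mix a) n (l + 1)) atTop := by
    intro l
    refine le_of_forall_pos_sub_le fun ε hε => ?_
    exact le_liminf_of_le (hbdA l).isCoboundedUnder_ge (slidingH_lower a ha (l + 1) (by omega) ε hε)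
  have hle : ∀ l : ℕ, liminf (fun n => slidingH (mix a) n (l + 1)) atTop ≤
      limsup (fun n => slidingH (mix a) n (l + 1)) atTop := fun l =>
    liminf_le_limsup (hbdA l) (hbdB l)
  have hlow' : ∀ l : ℕ, 1 / 2 ≤ limsup (fun n => slidingH (mix a) n (l + 1)) atTop :=
    fun l => (hlow l).trans (hle l)
  have hup : ∀ s : ℕ, limsup (fun n => slidingH (mix a) n (2 ^ (s + 1) - 1 + 1)) atTop ≤
      1 / 2 + ((s : ℝ) + 4) * (1 / 2) ^ (s + 1) := by
    intro s
    refine limsup_le_of_le (hbdB _).isCoboundedUnder_le (Eventually.of_forall fun n => ?_)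
    have : 2 ^ (s + 1) - 1 + 1 = 2 ^ (s + 1) := Nat.sub_add_cancel Nat.one_le_two_pow
    rw [this]
    exact upper_bound_pow a s n
  have hlim : Tendsto (fun s : ℕ => 1 / 2 + ((s : ℝ) + 4) * (1 / 2) ^ (s + 1)) atTop (𝓝 (1 / 2 : ℝ)) := by
    have := tail_tendsto.const_add (1 / 2)
    rwa [add_zero] at this
  have hb1 : BddBelow (Set.range fun l : ℕ => liminf (fun n => slidingH (mix a) n (l + 1)) atTop) :=
    ⟨1 / 2, by rintro _ ⟨l, rfl⟩; exact hlow l⟩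
  have hb2 : BddBelow (Set.range fun l : ℕ => limsup (fun n => slidingH (mix a) n (l + 1)) atTop) :=
    ⟨1 / 2, by rintro _ ⟨l, rfl⟩; exact hlow' l⟩
  constructor
  · refine le_antisymm (ge_of_tendsto' hlim fun s => ?_) (le_ciInf hlow)
    exact (ciInf_le hb1 (2 ^ (s + 1) - 1)).trans ((hle _).trans (hup s))
  · refine le_antisymm (ge_of_tendsto' hlim fun s => ?_) (le_ciInf hlow')
    exact (ciInf_le hb2 (2 ^ (s + 1) - 1)).trans (hup s)

lemma hasSum_half : HasSum (fun i : ℕ => ((2 : ℝ) ^ (i + 1))⁻¹) 1 := by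
  have := hasSum_geometric_two' (1 : ℝ)
  refine this.congr_fun ?_ |> fun h => h
  intro i
  rw [pow_succ]; field_simp

lemma eval_summable (y : Cantor) :
    Summable (fun i : ℕ => if y i then ((2:ℝ) ^ (i + 1))⁻¹ else 0) := by
  refine Summable.of_nonneg_of_le (fun i => ?_) (fun i => ?_) hasSum_half.summable
  · split_ifs <;> positivity
  · split_ifs
    · exact le_rfl
    · positivity

lemma eval_nonneg (y : Cantor) : 0 ≤ eval y := by
  unfold eval
  refine tsum_nonneg fun i => ?_
  split_ifs <;> positivity

lemma eval_le_one (y : Cantor) : eval y ≤ 1 := by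
  unfold eval
  rw [← hasSum_half.tsum_eq]
  refine Summable.tsum_le_tsum (fun i => ?_) (eval_summable y) hasSum_half.summable
  split_ifs
  · exact le_rfl
  · positivity

/-- values along the orbit -/
def V (a : Cantor) (j : ℕ) : ℝ := eval (shiftk (mix a) j)

lemma V_nonneg (a : Cantor) (j : ℕ) : 0 ≤ V a j := eval_nonneg _
lemma V_le_one (a : Cantor) (j : ℕ) : V a j ≤ 1 := eval_le_one _

lemma V_succ (a : Cantor) (j : ℕ) :
    V a j = (if mix a j then 1 / 2 else 0) + V a (j + 1) / 2 := by
  unfold V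
  conv_lhs => unfold eval
  rw [(eval_summable _).tsum_eq_zero_add]
  congr 1
  · simp [shiftk]
  · unfold eval
    rw [← tsum_div_const]
    refine tsum_congr fun i => ?_
    have hsh : shiftk (mix a) j (i + 1) = shiftk (mix a) (j + 1) i := by
      simp only [shiftk]
      congr 1; ring
    rw [hsh]
    split_ifs
    · rw [pow_succ _ (i + 1)]; field_simp
    · simp

lemma V_odd (a : Cantor) (i : ℕ) (hi : 1 ≤ i) :
    V a (2 * i - 1) = (if bet i then 1 / 2 else 0) + V a (2 * i) / 2 := by
  obtain ⟨k, rfl⟩ : ∃ k, i = k + 1 := ⟨i - 1, by omega⟩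
  rw [V_succ, show 2 * (k + 1) - 1 = 2 * k + 1 by omega, mix_odd]
  rfl

lemma V_even (a : Cantor) (i : ℕ) :
    V a (2 * i) = (if a i then 1 / 2 else 0) + (if bet (i + 1) then 1 / 4 else 0)
      + V a (2 * (i + 1)) / 4 := by
  rw [V_succ, mix_even, V_succ, mix_odd, show 2 * i + 1 + 1 = 2 * (i + 1) by ring]
  split_ifs <;> ring

lemma trig_lower (t : ℝ) (h0 : 0 ≤ t) (h1 : t ≤ 1) :
    -(7 * max (t - 2 / 3) 0) ≤ Real.sin (2 * π * t) + Real.sin (π * t) := by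
  have hs0 : 0 ≤ Real.sin (π * t) := Real.sin_nonneg_of_nonneg_of_le_pi
    (by positivity) (by nlinarith [Real.pi_pos])
  have hs1 := Real.sin_le_one (π * t)
  have e : Real.sin (2 * π * t) + Real.sin (π * t) = Real.sin (π * t) * (1 + 2 * Real.cos (π * t)) := by
    rw [mul_assoc, Real.sin_two_mul]; ring
  have hc : Real.cos (2 * π / 3) = -1 / 2 := by
    rw [show 2 * π / 3 = π - π / 3 by ring, Real.cos_pi_sub, Real.cos_pi_div_three]; norm_num
  rw [e]
  rcases le_total t (2 / 3) with h | h
  · rw [max_eq_right (by linarith)]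
    have : Real.cos (2 * π / 3) ≤ Real.cos (π * t) :=
      Real.cos_le_cos_of_nonneg_of_le_pi (by positivity) (by linarith [Real.pi_pos])
        (by nlinarith [Real.pi_pos])
    rw [hc] at this
    have : 0 ≤ Real.sin (π * t) * (1 + 2 * Real.cos (π * t)) := mul_nonneg hs0 (by linarith)
    linarith
  · rw [max_eq_left (by linarith)]
    have hlip : |Real.cos (π * t) - Real.cos (2 * π / 3)| ≤ |π * t - 2 * π / 3| := by
      have := Real.lipschitzWith_cos.dist_le_mul (π * t) (2 * π / 3)
      simpa [Real.dist_eq] using this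
    rw [hc, abs_of_nonneg (a := π * t - 2 * π / 3) (by nlinarith [Real.pi_pos])] at hlip
    have h3 := (abs_le.1 hlip).1
    have h4 : π * t - 2 * π / 3 ≤ 7 / 2 * (t - 2 / 3) := by
      nlinarith [Real.pi_lt_d2]
    have h5 : -(7 * (t - 2 / 3)) ≤ 1 + 2 * Real.cos (π * t) := by linarith
    nlinarith

lemma trig_upper (t : ℝ) (h0 : 0 ≤ t) (h1 : t ≤ 1) :
    Real.sin (2 * π * t) - Real.sin (π * t) ≤ 7 * max (1 / 3 - t) 0 := by
  have := trig_lower (1 - t) (by linarith) (by linarith)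
  rw [show 2 * π * (1 - t) = 2 * π - 2 * π * t by ring, Real.sin_two_pi_sub,
    show π * (1 - t) = π - π * t by ring, Real.sin_pi_sub,
    show 1 - t - 2 / 3 = 1 / 3 - t by ring] at this
  linarith

/-- sines -/
def sn (a : Cantor) (j : ℕ) : ℝ := Real.sin (2 * π * V a j)

def gg (a : Cantor) (i : ℕ) : ℝ := sn a (2 * i - 1) + sn a (2 * i)

lemma gg_abs (a : Cantor) (i : ℕ) : -2 ≤ gg a i ∧ gg a i ≤ 2 := by
  unfold gg sn
  constructor <;> linarith [Real.sin_le_one (2 * π * V a (2 * i - 1)), Real.sin_le_one (2 * π * V a (2 * i)),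
    Real.neg_one_le_sin (2 * π * V a (2 * i - 1)), Real.neg_one_le_sin (2 * π * V a (2 * i))]

def w01 : Fin 2 → Bool := ![false, true]

def cc (a : Cantor) (i : ℕ) : ℝ := indW 2 w01 (blockAt 2 i a)

lemma cc_cases (a : Cantor) (i : ℕ) :
    (cc a i = 1 ∧ a i = false ∧ a (i + 1) = true) ∨ cc a i = 0 := by
  unfold cc indW Set.indicator
  split_ifs with h
  · left
    simp only [Set.mem_singleton_iff] at h
    have h0 := congrFun h 0
    have h1 := congrFun h 1
    simp [blockAt, w01] at h0 h1
    exact ⟨rfl, h0, h1⟩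
  · right; rfl

lemma gg_false (a : Cantor) (i : ℕ) (hi : 1 ≤ i) (hb : bet i = false) :
    gg a i = Real.sin (2 * π * V a (2 * i)) + Real.sin (π * V a (2 * i)) := by
  unfold gg sn
  rw [V_odd a i hi, hb]
  simp only [Bool.false_eq_true, if_false]
  rw [show 2 * π * (0 + V a (2 * i) / 2) = π * V a (2 * i) by ring]; ring

lemma gg_true (a : Cantor) (i : ℕ) (hi : 1 ≤ i) (hb : bet i = true) :
    gg a i = Real.sin (2 * π * V a (2 * i)) - Real.sin (π * V a (2 * i)) := by
  unfold gg sn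
  rw [V_odd a i hi, hb]
  simp only [if_true]
  rw [show 2 * π * (1 / 2 + V a (2 * i) / 2) = π * V a (2 * i) + π by ring, Real.sin_add_pi]; ring

lemma gg_step_lower (a : Cantor) (i : ℕ) (hi : 1 ≤ i) (hb : bet i = false) (hb' : bet (i + 1) = false) :
    cc a i / 2 - 7 / 3 * (max (V a (2 * (i + 1)) - 2 / 3) 0 - max (V a (2 * i) - 2 / 3) 0) ≤ gg a i := by
  have ht := V_even a i
  rw [hb'] at ht
  simp only [Bool.false_eq_true, if_false] at ht
  have n0 := V_nonneg a (2 * i)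
  have n1 := V_le_one a (2 * i)
  have m0 := V_nonneg a (2 * (i + 1))
  have m1 := V_le_one a (2 * (i + 1))
  rw [gg_false a i hi hb]
  have hle : V a (2 * i) ≤ 1 / 2 + V a (2 * (i + 1)) / 4 := by
    rw [ht]; split_ifs <;> linarith
  have hmax : max (V a (2 * i) - 2 / 3) 0 ≤ max (V a (2 * (i + 1)) - 2 / 3) 0 / 4 := by
    apply max_le
    · have := le_max_left (V a (2 * (i + 1)) - 2 / 3) 0
      linarith
    · have := le_max_right (V a (2 * (i + 1)) - 2 / 3) 0
      linarith
  rcases cc_cases a i with ⟨hc, h0, h1⟩ | hc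
  · have hpos : max (V a (2 * i) - 2 / 3) 0 ≥ 0 := le_max_right _ _
    have ht2 := V_even a (i + 1)
    rw [h1] at ht2
    rw [h0] at ht
    simp only [Bool.false_eq_true, if_false, if_true] at ht ht2
    have l1 : 1 / 8 ≤ V a (2 * i) := by
      have p := V_nonneg a (2 * (i + 1 + 1))
      split_ifs at ht2 <;> linarith
    have l2 : V a (2 * i) ≤ 1 / 4 := by linarith
    have s1 : 0 ≤ Real.sin (π * V a (2 * i)) := Real.sin_nonneg_of_nonneg_of_le_pi
      (by positivity) (by nlinarith [Real.pi_pos])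
    have s2 : Real.sin (π / 6) ≤ Real.sin (2 * π * V a (2 * i)) := by
      apply Real.sin_le_sin_of_le_of_le_pi_div_two
      · linarith [Real.pi_pos]
      · nlinarith [Real.pi_pos]
      · nlinarith [Real.pi_pos]
    rw [Real.sin_pi_div_six] at s2
    rw [hc]
    linarith
  · rw [hc]
    have := trig_lower _ n0 n1
    linarith

lemma gg_step_upper (a : Cantor) (i : ℕ) (hi : 1 ≤ i) (hb : bet i = true) (hb' : bet (i + 1) = true) :
    gg a i ≤ 7 / 3 * (max (1 / 3 - V a (2 * (i + 1))) 0 - max (1 / 3 - V a (2 * i)) 0) := by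
  have ht := V_even a i
  rw [hb'] at ht
  simp only [if_true] at ht
  have n0 := V_nonneg a (2 * i)
  have n1 := V_le_one a (2 * i)
  rw [gg_true a i hi hb]
  have hle : 1 / 4 + V a (2 * (i + 1)) / 4 ≤ V a (2 * i) := by
    rw [ht]; split_ifs <;> linarith
  have hmax : max (1 / 3 - V a (2 * i)) 0 ≤ max (1 / 3 - V a (2 * (i + 1))) 0 / 4 := by
    apply max_le
    · have := le_max_left (1 / 3 - V a (2 * (i + 1))) 0
      linarith
    · have := le_max_right (1 / 3 - V a (2 * (i + 1))) 0
      linarith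
  have := trig_upper _ n0 n1
  linarith

lemma sum_lower (a : Cantor) (A d : ℕ) (hA : 1 ≤ A) (hb : ∀ i, A ≤ i → i ≤ A + d → bet i = false) :
    (∑ i ∈ Finset.Ico A (A + d), cc a i) / 2 - 7 / 3 * (max (V a (2 * (A + d)) - 2 / 3) 0
      - max (V a (2 * A) - 2 / 3) 0) ≤ ∑ i ∈ Finset.Ico A (A + d), gg a i := by
  induction d with
  | zero => simp
  | succ d ih =>
    rw [← add_assoc, Finset.sum_Ico_succ_top (by omega), Finset.sum_Ico_succ_top (by omega)]
    have h1 := ih (fun i h h' => hb i h (by omega))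
    have h2 := gg_step_lower a (A + d) (by omega) (hb _ (by omega) (by omega)) (hb _ (by omega) (by omega))
    linarith

lemma sum_upper (a : Cantor) (A d : ℕ) (hA : 1 ≤ A) (hb : ∀ i, A ≤ i → i ≤ A + d → bet i = true) :
    ∑ i ∈ Finset.Ico A (A + d), gg a i ≤ 7 / 3 * (max (1 / 3 - V a (2 * (A + d))) 0
      - max (1 / 3 - V a (2 * A)) 0) := by
  induction d with
  | zero => simp
  | succ d ih =>
    rw [← add_assoc, Finset.sum_Ico_succ_top (by omega)]
    have h1 := ih (fun i h h' => hb i h (by omega))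
    have h2 := gg_step_upper a (A + d) (by omega) (hb _ (by omega) (by omega)) (hb _ (by omega) (by omega))
    linarith

lemma stage_bet (k i : ℕ) (h1 : 2 ^ k ≤ i) (h2 : i < 2 ^ (k + 1)) : bet i = decide (k % 2 = 1) := by
  have h0 : 0 < 2 ^ k := by positivity
  have : Nat.log 2 i = k := by
    rw [Nat.log_eq_iff (Or.inr ⟨by norm_num, by omega⟩)]
    exact ⟨h1, h2⟩
  simp [bet, this]

lemma stage_lower (a : Cantor) (k : ℕ) (hk : k % 2 = 0) :
    (∑ i ∈ Finset.Ico (2 ^ k) (2 ^ (k + 1)), cc a i) / 2 - 4 ≤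
      ∑ i ∈ Finset.Ico (2 ^ k) (2 ^ (k + 1)), gg a i := by
  have h0 : 0 < 2 ^ k := by positivity
  have e : 2 ^ (k + 1) = 2 ^ k + (2 ^ k - 1) + 1 := by rw [pow_succ]; omega
  have h := sum_lower a (2 ^ k) (2 ^ k - 1) h0 (fun i h1 h2 => by
    rw [stage_bet k i h1 (by omega)]; simp [hk])
  rw [e, Finset.sum_Ico_succ_top (by omega), Finset.sum_Ico_succ_top (by omega)]
  have hg := (gg_abs a (2 ^ k + (2 ^ k - 1))).1
  have hc : cc a (2 ^ k + (2 ^ k - 1)) ≤ 1 := by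
    rcases cc_cases a (2 ^ k + (2 ^ k - 1)) with ⟨h, _⟩ | h <;> rw [h]; norm_num
  have m1 : max (V a (2 * (2 ^ k + (2 ^ k - 1))) - 2 / 3) 0 ≤ 1 / 3 :=
    max_le (by linarith [V_le_one a (2 * (2 ^ k + (2 ^ k - 1)))]) (by norm_num)
  have m2 : 0 ≤ max (V a (2 * 2 ^ k) - 2 / 3) 0 := le_max_right _ _
  linarith

lemma stage_upper (a : Cantor) (k : ℕ) (hk : k % 2 = 1) :
    ∑ i ∈ Finset.Ico (2 ^ k) (2 ^ (k + 1)), gg a i ≤ 4 := by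
  have h0 : 0 < 2 ^ k := by positivity
  have e : 2 ^ (k + 1) = 2 ^ k + (2 ^ k - 1) + 1 := by rw [pow_succ]; omega
  have h := sum_upper a (2 ^ k) (2 ^ k - 1) h0 (fun i h1 h2 => by
    rw [stage_bet k i h1 (by omega)]; simp [hk])
  rw [e, Finset.sum_Ico_succ_top (by omega)]
  have hg := (gg_abs a (2 ^ k + (2 ^ k - 1))).2
  have m1 : max (1 / 3 - V a (2 * (2 ^ k + (2 ^ k - 1)))) 0 ≤ 1 / 3 :=
    max_le (by linarith [V_nonneg a (2 * (2 ^ k + (2 ^ k - 1)))]) (by norm_num)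
  have m2 : 0 ≤ max (1 / 3 - V a (2 * 2 ^ k)) 0 := le_max_right _ _
  linarith

lemma sum_gg (a : Cantor) (A d : ℕ) (hA : 1 ≤ A) :
    ∑ i ∈ Finset.Ico A (A + d), gg a i = ∑ j ∈ Finset.range (2 * (A + d) - 1), sn a j
      - ∑ j ∈ Finset.range (2 * A - 1), sn a j := by
  induction d with
  | zero => simp
  | succ d ih =>
    rw [← add_assoc, Finset.sum_Ico_succ_top (by omega), ih,
      show 2 * (A + d + 1) - 1 = (2 * (A + d) - 1) + 1 + 1 by omega, Finset.sum_range_succ,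
      Finset.sum_range_succ, show 2 * (A + d) - 1 + 1 = 2 * (A + d) by omega]
    unfold gg
    ring

lemma weyl_im (a : Cantor) (n : ℕ) :
    (weylAvg (mix a) 1 n).im = (∑ j ∈ Finset.range n, sn a j) / n := by
  unfold weylAvg
  have h1 : ((n : ℂ)⁻¹) = (((n : ℝ)⁻¹ : ℝ) : ℂ) := by push_cast; rfl
  rw [h1, Complex.im_ofReal_mul, Complex.im_sum, div_eq_inv_mul]
  congr 1
  refine Finset.sum_congr rfl fun j _ => ?_
  have : (2 * (π : ℂ) * Complex.I * ((1 : ℤ) : ℂ) * ((eval (shiftk (mix a) j) : ℝ) : ℂ)) =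
      ((2 * π * V a j : ℝ) : ℂ) * Complex.I := by
    unfold V; push_cast; ring
  rw [this, Complex.exp_ofReal_mul_I_im]
  rfl

lemma weyl_diverges (a : Cantor) (ha : NormalSeq a) :
    ¬ ∃ c : ℂ, Tendsto (weylAvg (mix a) 1) atTop (𝓝 c) := by
  rintro ⟨c, hc⟩
  have him : Tendsto (fun n : ℕ => (∑ j ∈ Finset.range n, sn a j) / (n : ℝ)) atTop (𝓝 c.im) := by
    have := (Complex.continuous_im.tendsto c).comp hc
    refine this.congr fun n => ?_
    exact weyl_im a n
  have hpow : Tendsto (fun k : ℕ => 2 ^ k) atTop atTop := tendsto_pow_atTop_atTop_of_one_lt (by norm_num)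
  have hinv : Tendsto (fun k : ℕ => 1 / (2 : ℝ) ^ k) atTop (𝓝 0) := by
    have := tendsto_pow_atTop_nhds_zero_of_lt_one (r := (1 / 2 : ℝ)) (by norm_num) (by norm_num)
    simpa only [one_div_pow] using this
  have hsub : Tendsto (fun k : ℕ => 2 * 2 ^ k - 1) atTop atTop := by
    refine tendsto_atTop_mono (fun k => ?_) hpow
    have : 0 < 2 ^ k := by positivity
    omega
  have hS : Tendsto (fun k : ℕ => (∑ j ∈ Finset.range (2 * 2 ^ k - 1), sn a j) / (2 : ℝ) ^ k) atTop
      (𝓝 (c.im * 2)) := by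
    have h2 : Tendsto (fun k : ℕ => 2 - 1 / (2 : ℝ) ^ k) atTop (𝓝 2) := by
      simpa using hinv.const_sub 2
    refine ((him.comp hsub).mul h2).congr fun k => ?_
    have h3 : 1 ≤ 2 * 2 ^ k := by
      have : 0 < 2 ^ k := by positivity
      omega
    have h5 : (1 : ℝ) ≤ 2 ^ k := one_le_pow₀ (by norm_num)
    have h6 : 2 * (2 : ℝ) ^ k - 1 ≠ 0 := by linarith
    simp only [Function.comp]
    rw [Nat.cast_sub h3]
    push_cast
    field_simp
  have hD : Tendsto (fun k : ℕ => (∑ i ∈ Finset.Ico (2 ^ k) (2 ^ (k + 1)), gg a i) / (2 : ℝ) ^ k) atTop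
      (𝓝 (c.im * 2)) := by
    have h := ((hS.comp (tendsto_add_atTop_nat 1)).const_mul 2).sub hS
    rw [show 2 * (c.im * 2) - c.im * 2 = c.im * 2 by ring] at h
    refine h.congr fun k => ?_
    have h1 := sum_gg a (2 ^ k) (2 ^ k) Nat.one_le_two_pow
    rw [← two_mul, ← pow_succ'] at h1
    rw [h1]
    simp only [Function.comp]
    rw [pow_succ (2 : ℝ), show 2 ^ (k + 1) - 1 = 2 * 2 ^ k - 1 by rw [pow_succ']]
    field_simp
  have hC : Tendsto (fun k : ℕ => (∑ i ∈ Finset.Ico (2 ^ k) (2 ^ (k + 1)), cc a i) / (2 : ℝ) ^ k) atTop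
      (𝓝 (1 / 4)) := by
    have h0 := (ha 2 w01).comp hpow
    have h := ((h0.comp (tendsto_add_atTop_nat 1)).const_mul 2).sub h0
    rw [show 2 * ((2 : ℝ) ^ 2)⁻¹ - ((2 : ℝ) ^ 2)⁻¹ = 1 / 4 by norm_num] at h
    refine h.congr fun k => ?_
    rw [Finset.sum_Ico_eq_sub _ (Nat.pow_le_pow_right (by norm_num) (Nat.le_succ k))]
    simp only [Function.comp, cnt_eq_sum]
    push_cast
    rw [pow_succ (2 : ℝ)]
    unfold cc
    field_simp
  have he : Tendsto (fun r : ℕ => 2 * r) atTop atTop := tendsto_id.const_mul_atTop' (by norm_num)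
  have ho : Tendsto (fun r : ℕ => 2 * r + 1) atTop atTop := (tendsto_add_atTop_nat 1).comp he
  have hlow : 1 / 4 / 2 - 4 * 0 ≤ c.im * 2 := by
    refine le_of_tendsto_of_tendsto' (((hC.div_const 2).sub (hinv.const_mul 4)).comp he) (hD.comp he) fun r => ?_
    have := stage_lower a (2 * r) (by omega)
    simp only [Function.comp]
    have hp : (0 : ℝ) < 2 ^ (2 * r) := by positivity
    rw [le_div_iff₀ hp]
    refine le_trans (le_of_eq ?_) this
    field_simp
  have hup : c.im * 2 ≤ 4 * 0 := by
    refine le_of_tendsto_of_tendsto' (hD.comp ho) ((hinv.const_mul 4).comp ho) fun r => ?_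
    have := stage_upper a (2 * r + 1) (by omega)
    simp only [Function.comp]
    have hp : (0 : ℝ) < 2 ^ (2 * r + 1) := by positivity
    rw [div_le_iff₀ hp]
    refine le_trans this (le_of_eq ?_)
    field_simp
  linarith

/-- a regular sequence of dimension 1/2 with divergent Weyl averages. -/
theorem exists_regular_half_with_divergent_weyl :
    ∃ x : Cantor, dimFS x = 1 / 2 ∧ DimFS x = 1 / 2 ∧
      ∃ k : ℤ, ¬ ∃ c : ℂ, Tendsto (weylAvg x k) atTop (nhds c) := by
  obtain ⟨a, ha⟩ := exists_normal
  exact ⟨mix a, (dims a ha).1, (dims a ha).2, 1, weyl_diverges a ha⟩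

end
end

section
/- Let x ∈ {0,1}^∞, ν_n = (1/n) Σ_{j<n} δ_{T^j x}, and let W_x be the set of all weak subsequence limits of ⟨ν_n⟩. Then dim_FS(x) = inf_{μ ∈ W_x} H⁻(μ) and Dim_FS(x) = sup_{μ ∈ W_x} H⁺(μ). -/
open MeasureTheory Filter Topology Real
open scoped ENNReal

noncomputable section

lemma continuous_negMulLog2 : Continuous negMulLog2 := by
  have : negMulLog2 = fun p => Real.negMulLog p / Real.log 2 := funext negMulLog2_eq
  rw [this]
  exact Real.continuous_negMulLog.div_const _

lemma negMulLog2_nonneg {p : ℝ} (h0 : 0 ≤ p) (h1 : p ≤ 1) : 0 ≤ negMulLog2 p := by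
  rw [negMulLog2_eq]
  exact div_nonneg (Real.negMulLog_nonneg h0 h1) (Real.log_nonneg (by norm_num))

/-- Subadditivity of Shannon entropy (natural logarithm). -/
lemma entropy_subadd_nat {A B : Type*} [Fintype A] [Fintype B] (p : A × B → ℝ)
    (h0 : ∀ c, 0 ≤ p c) (h1 : ∑ c, p c = 1) :
    ∑ c, Real.negMulLog (p c) ≤
      ∑ a, Real.negMulLog (∑ b, p (a, b)) + ∑ b, Real.negMulLog (∑ a, p (a, b)) := by
  set q : A → ℝ := fun a => ∑ b, p (a, b) with hq
  set r : B → ℝ := fun b => ∑ a, p (a, b) with hr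
  have hq0 : ∀ a, 0 ≤ q a := fun a => Finset.sum_nonneg fun b _ => h0 _
  have hr0 : ∀ b, 0 ≤ r b := fun b => Finset.sum_nonneg fun a _ => h0 _
  have hpq : ∀ a b, p (a, b) ≤ q a := fun a b =>
    Finset.single_le_sum (f := fun b => p (a, b)) (fun b _ => h0 _) (Finset.mem_univ b)
  have hpr : ∀ a b, p (a, b) ≤ r b := fun a b =>
    Finset.single_le_sum (f := fun a => p (a, b)) (fun b _ => h0 _) (Finset.mem_univ a)
  have hsq : ∑ a, q a = 1 := by rw [← h1, Fintype.sum_prod_type]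
  have hsr : ∑ b, r b = 1 := by rw [← h1, Fintype.sum_prod_type_right]
  have key : ∀ a b, Real.negMulLog (p (a, b)) ≤
      -(p (a, b) * Real.log (q a)) + -(p (a, b) * Real.log (r b)) + (q a * r b - p (a, b)) := by
    intro a b
    rcases (h0 (a, b)).eq_or_lt with h | h
    · rw [← h]
      have := mul_nonneg (hq0 a) (hr0 b)
      simpa using this
    · have hqa : 0 < q a := h.trans_le (hpq a b)
      have hrb : 0 < r b := h.trans_le (hpr a b)
      have h3 := Real.log_le_sub_one_of_pos (x := q a * r b / p (a, b)) (by positivity)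
      rw [Real.log_div (by positivity) h.ne', Real.log_mul hqa.ne' hrb.ne'] at h3
      have h4 := mul_le_mul_of_nonneg_left h3 h.le
      have h5 : p (a, b) * (q a * r b / p (a, b) - 1) = q a * r b - p (a, b) := by
        field_simp
      rw [h5] at h4
      simp only [Real.negMulLog]
      linarith
  have hsum : ∑ c : A × B, Real.negMulLog (p c) ≤
      ∑ c : A × B, (-(p c * Real.log (q c.1)) + -(p c * Real.log (r c.2)) +
        (q c.1 * r c.2 - p c)) := Finset.sum_le_sum fun c _ => key c.1 c.2
  refine hsum.trans (le_of_eq ?_)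
  rw [Finset.sum_add_distrib, Finset.sum_add_distrib, Finset.sum_sub_distrib, h1]
  have e1 : ∑ c : A × B, -(p c * Real.log (q c.1)) = ∑ a, Real.negMulLog (q a) := by
    rw [Fintype.sum_prod_type]
    refine Finset.sum_congr rfl fun a _ => ?_
    simp only [Real.negMulLog]
    rw [Finset.sum_neg_distrib, ← Finset.sum_mul]
    simp only [hq]
    ring
  have e2 : ∑ c : A × B, -(p c * Real.log (r c.2)) = ∑ b, Real.negMulLog (r b) := by
    rw [Fintype.sum_prod_type_right]
    refine Finset.sum_congr rfl fun a _ => ?_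
    simp only [Real.negMulLog]
    rw [Finset.sum_neg_distrib, ← Finset.sum_mul]
    simp only [hr]
    ring
  have e3 : ∑ c : A × B, q c.1 * r c.2 = 1 := by
    rw [Fintype.sum_prod_type]
    simp only [← Finset.mul_sum, hsr, mul_one, hsq]
  rw [e1, e2, e3]
  ring

lemma entropy_subadd {A B : Type*} [Fintype A] [Fintype B] (p : A × B → ℝ)
    (h0 : ∀ c, 0 ≤ p c) (h1 : ∑ c, p c = 1) :
    ∑ c, negMulLog2 (p c) ≤
      ∑ a, negMulLog2 (∑ b, p (a, b)) + ∑ b, negMulLog2 (∑ a, p (a, b)) := by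
  simp only [negMulLog2_eq, ← Finset.sum_div, ← add_div]
  exact div_le_div_of_nonneg_right (entropy_subadd_nat p h0 h1) (Real.log_nonneg (by norm_num))

/-! ### Clopen sets and invariance -/

lemma isClopen_Cyl (l : ℕ) (w : Fin l → Bool) : IsClopen (Cyl l w) := by
  have : Cyl l w = ⋂ j : Fin l, (fun y : Cantor => y (j : ℕ)) ⁻¹' {w j} := by
    ext y; simp [Cyl]
  rw [this]
  exact isClopen_iInter_of_finite fun j =>
    (isClopen_discrete _).preimage (continuous_apply _)

lemma continuous_shift (m : ℕ) : Continuous (fun y : Cantor => shiftk y m) :=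
  continuous_pi fun i => continuous_apply (i + m)

lemma continuous_real_clopen {A : Set Cantor} (hA : IsClopen A) :
    Continuous (fun μ : ProbabilityMeasure Cantor => (μ : Measure Cantor).real A) := by
  rw [continuous_iff_continuousAt]
  intro μ
  have := ProbabilityMeasure.tendsto_measure_of_null_frontier_of_tendsto'
    (μs := fun ν : ProbabilityMeasure Cantor => ν) (L := 𝓝 μ) (μ := μ) tendsto_id (E := A)
    (by rw [hA.frontier_eq]; simp)
  exact (ENNReal.tendsto_toReal (measure_ne_top _ _)).comp this

lemma continuous_measH (l : ℕ) :
    Continuous (fun μ : ProbabilityMeasure Cantor => measH (μ : Measure Cantor) l) := by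
  unfold measH
  exact continuous_finsetSum _ fun w _ =>
    continuous_negMulLog2.comp (continuous_real_clopen (isClopen_Cyl l w))

instance (x : Cantor) (n : ℕ) : IsProbabilityMeasure (empMeas x (n + 1)) := by
  constructor
  simp only [empMeas, Measure.smul_apply, Measure.finsetSum_apply, measure_univ, Finset.sum_const,
    Finset.card_range, smul_eq_mul, nsmul_eq_mul, mul_one]
  exact ENNReal.inv_mul_cancel (by simp) (ENNReal.natCast_ne_top _)

/-- empirical measures as probability measures -/
def empP (x : Cantor) (n : ℕ) : ProbabilityMeasure Cantor := ⟨empMeas x (n + 1), inferInstance⟩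

lemma empMeas_real (x : Cantor) (n : ℕ) {A : Set Cantor} (hA : MeasurableSet A) :
    (empMeas x n).real A =
      (∑ j ∈ Finset.range n, A.indicator (fun _ => (1 : ℝ)) (shiftk x j)) / n := by
  simp only [Measure.real, empMeas, Measure.smul_apply, Measure.finsetSum_apply, smul_eq_mul,
    ENNReal.toReal_mul, ENNReal.toReal_inv, ENNReal.toReal_natCast]
  rw [ENNReal.toReal_sum (fun _ _ => measure_ne_top _ _), inv_mul_eq_div]
  congr 1
  refine Finset.sum_congr rfl fun j _ => ?_
  rw [Measure.dirac_apply' _ hA]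
  by_cases h : shiftk x j ∈ A <;> simp [h]

/-- cluster points of the empirical measures -/
def Wc (x : Cantor) : Set (ProbabilityMeasure Cantor) :=
  {μ | MapClusterPt μ atTop (empP x)}

lemma isClosed_Wc (x : Cantor) : IsClosed (Wc x) := isClosed_setOfPred_clusterPt

lemma shift_inv_one {x : Cantor} {μ : ProbabilityMeasure Cantor} (hμ : μ ∈ Wc x)
    {A : Set Cantor} (hA : IsClopen A) :
    (μ : Measure Cantor).real ((fun y : Cantor => shiftk y 1) ⁻¹' A) =
      (μ : Measure Cantor).real A := by
  have hB : IsClopen ((fun y : Cantor => shiftk y 1) ⁻¹' A) := hA.preimage (continuous_shift 1)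
  set B := (fun y : Cantor => shiftk y 1) ⁻¹' A with hBdef
  have hc : Continuous (fun ν : ProbabilityMeasure Cantor =>
      (ν : Measure Cantor).real B - (ν : Measure Cantor).real A) :=
    (continuous_real_clopen hB).sub (continuous_real_clopen hA)
  have h1 : MapClusterPt _ atTop _ := MapClusterPt.continuousAt_comp hc.continuousAt hμ
  have h2 : Tendsto ((fun ν : ProbabilityMeasure Cantor =>
      (ν : Measure Cantor).real B - (ν : Measure Cantor).real A) ∘ empP x) atTop (𝓝 0) := by
    have h3 : Tendsto (fun n : ℕ => 1 / ((n : ℝ) + 1)) atTop (𝓝 0) :=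
      tendsto_one_div_add_atTop_nhds_zero_nat
    refine squeeze_zero_norm (fun n => ?_) h3
    have e : ((empP x n : ProbabilityMeasure Cantor) : Measure Cantor) = empMeas x (n + 1) := rfl
    simp only [Function.comp, e]
    rw [empMeas_real _ _ hB.isOpen.measurableSet, empMeas_real _ _ hA.isOpen.measurableSet, ← sub_div,
      ← Finset.sum_sub_distrib]
    have e2 : ∀ j, B.indicator (fun _ => (1 : ℝ)) (shiftk x j) =
        A.indicator (fun _ => (1 : ℝ)) (shiftk x (j + 1)) := by
      intro j
      have : shiftk (shiftk x j) 1 = shiftk x (j + 1) := by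
        funext i; simp only [shiftk]; congr 1; omega
      have hm : shiftk x j ∈ B ↔ shiftk x (j + 1) ∈ A := by
        rw [← this]; exact Iff.rfl
      by_cases hj : shiftk x (j + 1) ∈ A
      · rw [Set.indicator_of_mem hj, Set.indicator_of_mem (hm.2 hj)]
      · rw [Set.indicator_of_notMem hj, Set.indicator_of_notMem (fun h => hj (hm.1 h))]
    simp only [e2]
    rw [Finset.sum_range_sub (fun j => A.indicator (fun _ => (1 : ℝ)) (shiftk x j)), norm_div]
    have hn : ‖((n + 1 : ℕ) : ℝ)‖ = (n : ℝ) + 1 := by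
      rw [Real.norm_natCast]; push_cast; rfl
    rw [hn]
    refine div_le_div_of_nonneg_right ?_ (by positivity)
    simp only [Set.indicator]
    split_ifs <;> simp
  have h4 : (μ : Measure Cantor).real B - (μ : Measure Cantor).real A = 0 := by
    have := h1.clusterPt.mono h2
    exact eq_of_nhds_neBot this
  linarith

lemma shift_inv {x : Cantor} {μ : ProbabilityMeasure Cantor} (hμ : μ ∈ Wc x)
    (m : ℕ) {A : Set Cantor} (hA : IsClopen A) :
    (μ : Measure Cantor).real ((fun y : Cantor => shiftk y m) ⁻¹' A) =
      (μ : Measure Cantor).real A := by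
  induction m with
  | zero => rfl
  | succ m ih =>
    rw [← ih, ← shift_inv_one hμ (hA.preimage (continuous_shift m))]
    congr 1

lemma Cyl_append (m n : ℕ) (a : Fin m → Bool) (b : Fin n → Bool) :
    Cyl (m + n) (Fin.append a b) = Cyl m a ∩ (fun y : Cantor => shiftk y m) ⁻¹' Cyl n b := by
  ext y
  simp only [Cyl, Set.mem_ofPred_eq, Set.mem_inter_iff, Set.mem_preimage, shiftk]
  constructor
  · intro h
    refine ⟨fun j => ?_, fun j => ?_⟩
    · simpa using h (Fin.castAdd n j)
    · have := h (Fin.natAdd m j)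
      simpa [add_comm] using this
  · rintro ⟨h1, h2⟩ j
    refine Fin.addCases (fun j => ?_) (fun j => ?_) j
    · simpa using h1 j
    · simpa [add_comm] using h2 j

lemma sum_Cyl_inter (μ : Measure Cantor) [IsFiniteMeasure μ] (n : ℕ) {A : Set Cantor}
    (f : Cantor → Cantor) (hf : Continuous f) (hA : MeasurableSet A) :
    ∑ b : Fin n → Bool, μ.real (A ∩ f ⁻¹' Cyl n b) = μ.real A := by
  rw [← measureReal_iUnion_fintype]
  · congr 1
    ext y
    simp only [Set.mem_iUnion, Set.mem_inter_iff, Set.mem_preimage, Cyl, Set.mem_ofPred_eq]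
    exact ⟨fun ⟨_, h, _⟩ => h, fun h => ⟨fun j => f y j, h, fun _ => rfl⟩⟩
  · intro a b hab
    refine Set.disjoint_left.2 fun y hy hy2 => hab ?_
    funext j
    exact (hy.2 j).symm.trans (hy2.2 j)
  · exact fun b => hA.inter (((isClopen_Cyl n b).preimage hf).isOpen.measurableSet)

lemma measH_subadd {x : Cantor} {μ : ProbabilityMeasure Cantor} (hμ : μ ∈ Wc x) :
    Subadditive (measH (μ : Measure Cantor)) := by
  intro m n
  set M := (μ : Measure Cantor) with hM
  set p : (Fin m → Bool) × (Fin n → Bool) → ℝ := fun c => M.real (Cyl (m + n) (Fin.append c.1 c.2))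
    with hp
  have hpa : ∀ a, ∑ b, p (a, b) = M.real (Cyl m a) := by
    intro a
    simp only [hp, Cyl_append]
    exact sum_Cyl_inter M n _ (continuous_shift m) (isClopen_Cyl m a).isOpen.measurableSet
  have hpb : ∀ b, ∑ a, p (a, b) = M.real (Cyl n b) := by
    intro b
    simp only [hp, Cyl_append]
    rw [← shift_inv hμ m (isClopen_Cyl n b)]
    have := sum_Cyl_inter M m (A := (fun y : Cantor => shiftk y m) ⁻¹' Cyl n b) id continuous_id
      ((isClopen_Cyl n b).preimage (continuous_shift m)).isOpen.measurableSet
    rw [← this]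
    exact Finset.sum_congr rfl fun a _ => by rw [Set.inter_comm]; rfl
  have h1 : ∑ c, p c = 1 := by
    rw [Fintype.sum_prod_type]
    simp only [hpa]
    have := sum_Cyl_inter M m (A := Set.univ) id continuous_id MeasurableSet.univ
    simpa using this
  have h := entropy_subadd p (fun c => measureReal_nonneg) h1
  simp only [hpa, hpb] at h
  have e : measH M (m + n) = ∑ c, negMulLog2 (p c) := by
    unfold measH
    rw [← (Fin.appendEquiv m n).sum_comp]
    rfl
  rw [e]
  exact h

lemma measH_nonneg (μ : ProbabilityMeasure Cantor) (n : ℕ) : 0 ≤ measH (μ : Measure Cantor) n :=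
  Finset.sum_nonneg fun _ _ => negMulLog2_nonneg measureReal_nonneg measureReal_le_one

lemma exists_lim {x : Cantor} {μ : ProbabilityMeasure Cantor} (hμ : μ ∈ Wc x) :
    ∃ L : ℝ, Tendsto (fun n : ℕ => measH (μ : Measure Cantor) n / n) atTop (𝓝 L) ∧
      Hminus μ = L ∧ Hplus μ = L ∧ 0 ≤ L ∧
      ∀ l : ℕ, L ≤ measH (μ : Measure Cantor) (l + 1) / ((l + 1 : ℕ) : ℝ) := by
  have hb : BddBelow (Set.range fun n : ℕ => measH (μ : Measure Cantor) n / n) :=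
    ⟨0, by rintro _ ⟨n, rfl⟩; exact div_nonneg (measH_nonneg _ _) (Nat.cast_nonneg _)⟩
  have ht := (measH_subadd hμ).tendsto_lim hb
  refine ⟨_, ht, ht.liminf_eq, ht.limsup_eq, ?_, fun l => ?_⟩
  · exact ge_of_tendsto' ht fun n => div_nonneg (measH_nonneg _ _) (Nat.cast_nonneg _)
  · exact (measH_subadd hμ).lim_le_div hb (Nat.succ_ne_zero l)

/-! ### Identification of sliding block entropies and of `Wx` -/

/-- normalised block entropy -/
def hl (l : ℕ) (μ : ProbabilityMeasure Cantor) : ℝ :=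
  measH (μ : Measure Cantor) (l + 1) / ((l + 1 : ℕ) : ℝ)

lemma continuous_hl (l : ℕ) : Continuous (hl l) := (continuous_measH (l + 1)).div_const _

lemma slidingH_eq (x : Cantor) (l n : ℕ) :
    slidingH x (n + (l + 1)) (l + 1) = hl l (empP x n) := by
  unfold slidingH hl measH
  rw [one_div, inv_mul_eq_div]
  congr 1
  refine Finset.sum_congr rfl fun w _ => ?_
  congr 1
  change _ = (empMeas x (n + 1)).real (Cyl (l + 1) w)
  rw [empMeas_real _ _ (isClopen_Cyl _ w).isOpen.measurableSet]
  unfold slidingP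
  rw [Nat.add_sub_cancel]
  congr 1
  rw [Finset.card_filter]
  push_cast
  refine Finset.sum_congr rfl fun j _ => ?_
  simp only [Set.indicator, Cyl, Set.mem_ofPred_eq, shiftk, add_comm]

lemma liminf_slidingH (x : Cantor) (l : ℕ) :
    liminf (fun n => slidingH x n (l + 1)) atTop = liminf (hl l ∘ empP x) atTop := by
  rw [← liminf_nat_add (fun n => slidingH x n (l + 1)) (l + 1)]
  simp only [slidingH_eq]
  rfl

lemma limsup_slidingH (x : Cantor) (l : ℕ) :
    limsup (fun n => slidingH x n (l + 1)) atTop = limsup (hl l ∘ empP x) atTop := by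
  rw [← limsup_nat_add (fun n => slidingH x n (l + 1)) (l + 1)]
  simp only [slidingH_eq]
  rfl

lemma Wx_eq (x : Cantor) : Wx x = (fun μ : ProbabilityMeasure Cantor => (μ : Measure Cantor)) ''
    Wc x := by
  ext μ
  constructor
  · rintro ⟨hp, φ, hφ, hpos, hw⟩
    let μ' : ProbabilityMeasure Cantor := ⟨μ, hp⟩
    refine ⟨μ', ?_, rfl⟩
    have hψ : Tendsto (fun m => φ m - 1) atTop atTop :=
      (tendsto_sub_atTop_nat 1).comp hφ.tendsto_atTop
    refine MapClusterPt.of_comp hψ (Tendsto.mapClusterPt ?_)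
    rw [ProbabilityMeasure.tendsto_iff_forall_integral_rclike_tendsto ℂ]
    intro f
    refine (hw f).congr fun m => ?_
    have : φ m - 1 + 1 = φ m := Nat.sub_add_cancel (hpos m)
    change _ = ∫ y, f y ∂(empMeas x (φ m - 1 + 1))
    rw [this]
  · rintro ⟨μ, hμ, rfl⟩
    obtain ⟨ψ, hψ, ht⟩ := MapClusterPt.tendsto_subseq hμ
    refine ⟨μ.2, fun m => ψ m + 1, fun a b h => Nat.succ_lt_succ (hψ h), fun m => Nat.succ_pos _, ?_⟩
    rw [ProbabilityMeasure.tendsto_iff_forall_integral_rclike_tendsto ℂ] at ht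
    exact fun f => ht f

/-! ### Cluster points in compact spaces -/

section cluster

variable {X : Type*} [TopologicalSpace X] [CompactSpace X]

lemma bdd_above_comp {h : X → ℝ} (hh : Continuous h) (P : ℕ → X) :
    IsBoundedUnder (· ≤ ·) atTop (h ∘ P) := by
  obtain ⟨C, hC⟩ := (isCompact_range hh).bddAbove
  exact isBoundedUnder_of ⟨C, fun n => hC ⟨P n, rfl⟩⟩

lemma bdd_below_comp {h : X → ℝ} (hh : Continuous h) (P : ℕ → X) :
    IsBoundedUnder (· ≥ ·) atTop (h ∘ P) := by
  obtain ⟨C, hC⟩ := (isCompact_range hh).bddBelow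
  exact isBoundedUnder_of ⟨C, fun n => hC ⟨P n, rfl⟩⟩

lemma le_limsup_of_cluster {h : X → ℝ} (hh : Continuous h) {P : ℕ → X} {μ : X}
    (hμ : MapClusterPt μ atTop P) : h μ ≤ limsup (h ∘ P) atTop := by
  by_contra! hlt
  obtain ⟨c, hc1, hc2⟩ := exists_between hlt
  have h1 := eventually_lt_of_limsup_lt hc1 (bdd_above_comp hh P)
  have h2 : ∃ᶠ n in atTop, c < h (P n) :=
    hμ.frequently (hh.continuousAt.eventually (lt_mem_nhds hc2))
  obtain ⟨n, hn1, hn2⟩ := (h2.and_eventually h1).exists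
  exact lt_asymm hn1 hn2

lemma liminf_le_of_cluster {h : X → ℝ} (hh : Continuous h) {P : ℕ → X} {μ : X}
    (hμ : MapClusterPt μ atTop P) : liminf (h ∘ P) atTop ≤ h μ := by
  by_contra! hlt
  obtain ⟨c, hc1, hc2⟩ := exists_between hlt
  have h1 := eventually_lt_of_lt_liminf hc2 (bdd_below_comp hh P)
  have h2 : ∃ᶠ n in atTop, h (P n) < c :=
    hμ.frequently (hh.continuousAt.eventually (gt_mem_nhds hc1))
  obtain ⟨n, hn1, hn2⟩ := (h2.and_eventually h1).exists
  exact lt_asymm hn1 hn2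

lemma exists_cluster_of_comp {h : X → ℝ} (hh : Continuous h) {P : ℕ → X} {L : ℝ}
    (hL : MapClusterPt L atTop (h ∘ P)) : ∃ μ, MapClusterPt μ atTop P ∧ h μ = L := by
  obtain ⟨U, hU, ht⟩ := mapClusterPt_iff_ultrafilter.1 hL
  obtain ⟨μ, -, hμ⟩ := isCompact_univ.ultrafilter_le_nhds (U.map P) (by simp)
  have hμ' : Tendsto P U (𝓝 μ) := hμ
  exact ⟨μ, mapClusterPt_iff_ultrafilter.2 ⟨U, hU, hμ'⟩,
    tendsto_nhds_unique ((hh.tendsto μ).comp hμ') ht⟩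

lemma exists_limsup {h : X → ℝ} (hh : Continuous h) (P : ℕ → X) :
    ∃ μ, MapClusterPt μ atTop P ∧ h μ = limsup (h ∘ P) atTop := by
  refine exists_cluster_of_comp hh ?_
  rw [mapClusterPt_iff_frequently]
  intro s hs
  obtain ⟨a, b, hab, hs⟩ := mem_nhds_iff_exists_Ioo_subset.1 hs
  have h1 := eventually_lt_of_limsup_lt hab.2 (bdd_above_comp hh P)
  have h2 := frequently_lt_of_lt_limsup (bdd_below_comp hh P).isCoboundedUnder_le hab.1
  exact (h2.and_eventually h1).mono fun n hn => hs hn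

lemma exists_liminf {h : X → ℝ} (hh : Continuous h) (P : ℕ → X) :
    ∃ μ, MapClusterPt μ atTop P ∧ h μ = liminf (h ∘ P) atTop := by
  refine exists_cluster_of_comp hh ?_
  rw [mapClusterPt_iff_frequently]
  intro s hs
  obtain ⟨a, b, hab, hs⟩ := mem_nhds_iff_exists_Ioo_subset.1 hs
  have h1 := eventually_lt_of_lt_liminf hab.1 (bdd_below_comp hh P)
  have h2 := frequently_lt_of_liminf_lt (bdd_above_comp hh P).isCoboundedUnder_ge hab.2
  exact (h2.and_eventually h1).mono fun n hn => hs ⟨hn.2, hn.1⟩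

end cluster

lemma hl_nonneg (l : ℕ) (μ : ProbabilityMeasure Cantor) : 0 ≤ hl l μ :=
  div_nonneg (measH_nonneg _ _) (Nat.cast_nonneg _)

/-- monotonicity of the normalised entropies along powers of two -/
lemma hl_two_pow_anti {x : Cantor} {μ : ProbabilityMeasure Cantor} (hμ : μ ∈ Wc x) (k : ℕ) :
    hl (2 ^ (k + 1) - 1) μ ≤ hl (2 ^ k - 1) μ := by
  unfold hl
  rw [Nat.sub_add_cancel Nat.one_le_two_pow, Nat.sub_add_cancel Nat.one_le_two_pow]
  have h := measH_subadd hμ (2 ^ k) (2 ^ k)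
  have e : 2 ^ (k + 1) = 2 ^ k + 2 ^ k := by ring
  rw [e]
  push_cast
  have hp : (0 : ℝ) < 2 ^ k := by positivity
  rw [div_le_div_iff₀ (by positivity) hp]
  nlinarith

/-- Weyl criterion for finite-state dimension via weak subsequence limits. -/
theorem dimFS_eq_inf_Hminus_and_DimFS_eq_sup_Hplus (x : Cantor) :
    dimFS x = sInf (Hminus '' Wx x) ∧ DimFS x = sSup (Hplus '' Wx x) := by
  have hne : (Wc x).Nonempty := by
    obtain ⟨μ, hμ, -⟩ := exists_limsup (continuous_hl 0) (empP x)
    exact ⟨μ, hμ⟩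
  rw [Wx_eq, Set.image_image, Set.image_image]
  unfold dimFS DimFS
  simp only [liminf_slidingH, limsup_slidingH]
  constructor
  · have hb1 : BddBelow (Set.range fun l : ℕ => liminf (hl l ∘ empP x) atTop) := by
      refine ⟨0, ?_⟩
      rintro _ ⟨l, rfl⟩
      obtain ⟨μ, -, e⟩ := exists_liminf (continuous_hl l) (empP x)
      simp only [← e]
      exact hl_nonneg l μ
    have hb2 : BddBelow ((fun μ : ProbabilityMeasure Cantor => Hminus (μ : Measure Cantor)) ''
        Wc x) := by
      refine ⟨0, ?_⟩
      rintro _ ⟨μ, hμ, rfl⟩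
      obtain ⟨L, -, h1, -, h2, -⟩ := exists_lim hμ
      simp only [h1]
      exact h2
    apply le_antisymm
    · refine le_csInf (hne.image _) ?_
      rintro _ ⟨μ, hμ, rfl⟩
      obtain ⟨L, ht, h1, -, -, -⟩ := exists_lim hμ
      simp only [h1]
      refine ge_of_tendsto' ((tendsto_add_atTop_iff_nat 1).2 ht) fun l => ?_
      exact (ciInf_le hb1 l).trans (liminf_le_of_cluster (continuous_hl l) hμ)
    · refine le_ciInf fun l => ?_
      obtain ⟨μ, hμ, e⟩ := exists_liminf (continuous_hl l) (empP x)
      rw [← e]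
      refine (csInf_le hb2 ⟨μ, hμ, rfl⟩).trans ?_
      obtain ⟨L, -, h1, -, -, h2⟩ := exists_lim (x := x) hμ
      simp only [h1]
      exact h2 l
  · have hb1 : BddBelow (Set.range fun l : ℕ => limsup (hl l ∘ empP x) atTop) := by
      refine ⟨0, ?_⟩
      rintro _ ⟨l, rfl⟩
      obtain ⟨μ, -, e⟩ := exists_limsup (continuous_hl l) (empP x)
      simp only [← e]
      exact hl_nonneg l μ
    have hle : ∀ l : ℕ, ∀ μ ∈ Wc x, Hplus (μ : Measure Cantor) ≤ limsup (hl l ∘ empP x) atTop := by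
      intro l μ hμ
      obtain ⟨L, -, -, h1, -, h2⟩ := exists_lim hμ
      rw [h1]
      exact (h2 l).trans (le_limsup_of_cluster (continuous_hl l) hμ)
    have hb2 : BddAbove ((fun μ : ProbabilityMeasure Cantor => Hplus (μ : Measure Cantor)) ''
        Wc x) := by
      refine ⟨limsup (hl 0 ∘ empP x) atTop, ?_⟩
      rintro _ ⟨μ, hμ, rfl⟩
      exact hle 0 μ hμ
    apply le_antisymm
    · set D := ⨅ l : ℕ, limsup (hl l ∘ empP x) atTop with hD
      set K : ℕ → Set (ProbabilityMeasure Cantor) :=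
        fun k => Wc x ∩ {μ | D ≤ hl (2 ^ k - 1) μ} with hK
      have hKc : ∀ k, IsClosed (K k) := fun k =>
        (isClosed_Wc x).inter (isClosed_le continuous_const (continuous_hl _))
      obtain ⟨μ, hμ⟩ := IsCompact.nonempty_iInter_of_sequence_nonempty_isCompact_isClosed K
        (fun k μ h => ⟨h.1, le_trans h.2 (hl_two_pow_anti h.1 k)⟩)
        (fun k => by
          obtain ⟨μ, hμ, e⟩ := exists_limsup (continuous_hl (2 ^ k - 1)) (empP x)
          refine ⟨μ, hμ, ?_⟩
          simp only [Set.mem_ofPred_eq, e]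
          exact ciInf_le hb1 _)
        (hKc 0).isCompact hKc
      rw [Set.mem_iInter] at hμ
      have hμW : μ ∈ Wc x := (hμ 0).1
      refine le_trans ?_ (le_csSup hb2 ⟨μ, hμW, rfl⟩)
      obtain ⟨L, ht, -, h1, -, -⟩ := exists_lim hμW
      simp only [h1]
      have ht2 := ht.comp (tendsto_pow_atTop_atTop_of_one_lt (α := ℕ) one_lt_two)
      refine ge_of_tendsto' ht2 fun k => ?_
      have := (hμ k).2
      simp only [Set.mem_ofPred_eq, hl, Nat.sub_add_cancel Nat.one_le_two_pow] at this
      exact this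
    · refine csSup_le (hne.image _) ?_
      rintro _ ⟨μ, hμ, rfl⟩
      exact le_ciInf fun l => hle l μ hμ

end
end
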